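/- Let G_1 and G_2 be maxnil graphs and let G be the clique sum of G_1 and G_2 over a triangle Δ with vertex set {x, y, z} = V(G_1) ∩ V(G_2). Assume {x, y, z} is a minimal vertex cut set of G. Then G is maxnil if and only if there exists i ∈ {1, 2} such that every induced K_4 subgraph of G_i of the form induced by {x, y, z, t} (with t a vertex of G_i) is strongly separating in G_i. -/

import Mathlib

open SimpleGraph

/-- `H` is a minor of `G`: there is a family of nonempty, pairwise disjoint,
connected branch sets in `G`, one for each vertex of `H`, with an edge of `G`
between the branch sets of any two adjacent vertices of `H`. -/
def IsMinor {W V : Type} (H : SimpleGraph W) (G : SimpleGraph V) : Prop :=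
  ∃ f : W → Set V,
    (∀ w, (f w).Nonempty) ∧
    (∀ w, (G.induce (f w)).Connected) ∧
    (Pairwise fun w₁ w₂ => Disjoint (f w₁) (f w₂)) ∧
    ∀ ⦃w₁ w₂⦄, H.Adj w₁ w₂ → ∃ v₁ ∈ f w₁, ∃ v₂ ∈ f w₂, G.Adj v₁ v₂

/-- The result of a `∇Y`-move on the triangle `a b c` of `G`: delete the edges of
the triangle and add a new vertex (`none`) joined to `a`, `b`, `c`. -/
def triangleY {V : Type} (G : SimpleGraph V) (a b c : V) : SimpleGraph (Option V) :=
  (SimpleGraph.map Function.Embedding.some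
      (G.deleteEdges {s(a, b), s(b, c), s(a, c)})) ⊔
    SimpleGraph.fromEdgeSet {s((none : Option V), some a), s(none, some b), s(none, some c)}

/-- Membership in the Petersen family: the graphs obtained from `K₆` by
`∇Y`-moves and `Y∇`-moves (the inverse operation), up to isomorphism. -/
inductive IsPetersenFamily : ∀ {V : Type}, SimpleGraph V → Prop
  | k6 : IsPetersenFamily (⊤ : SimpleGraph (Fin 6))
  | deltaY {V : Type} {G : SimpleGraph V} {a b c : V} :
      IsPetersenFamily G → G.Adj a b → G.Adj b c → G.Adj a c →
      IsPetersenFamily (triangleY G a b c)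
  | yDelta {V : Type} {G : SimpleGraph V} {a b c : V} :
      IsPetersenFamily (triangleY G a b c) → G.Adj a b → G.Adj b c → G.Adj a c →
      IsPetersenFamily G
  | iso {V W : Type} {G : SimpleGraph V} {H : SimpleGraph W} :
      IsPetersenFamily G → G ≃g H → IsPetersenFamily H

/-- A graph is linklessly embeddable (nIL) iff it has no minor in the Petersen family. -/
def IsLinkless {V : Type} (G : SimpleGraph V) : Prop :=
  ∀ ⦃W : Type⦄ (P : SimpleGraph W), IsPetersenFamily P → ¬ IsMinor P G

/-- The graph obtained from `G` by adding the edge `ab`. -/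
def addEdge {V : Type} (G : SimpleGraph V) (a b : V) : SimpleGraph V :=
  G ⊔ SimpleGraph.fromEdgeSet {s(a, b)}

/-- A nIL graph is maxnil if adding any edge yields a graph that is not nIL. -/
def IsMaxnil {V : Type} (G : SimpleGraph V) : Prop :=
  IsLinkless G ∧ ∀ a b : V, a ≠ b → ¬ G.Adj a b → ¬ IsLinkless (addEdge G a b)

/-- `S` is a vertex cut set of the connected graph `G` if `G - S` is disconnected. -/
def IsVertexCut {V : Type} (G : SimpleGraph V) (S : Set V) : Prop :=
  G.Connected ∧ ¬ (G.induce Sᶜ).Preconnected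

/-- A vertex cut set is minimal if no proper subset of it is a vertex cut set. -/
def IsMinimalVertexCut {V : Type} (G : SimpleGraph V) (S : Set V) : Prop :=
  IsVertexCut G S ∧ ∀ S' ⊂ S, ¬ IsVertexCut G S'

/-- A set `T` of vertices of `H` (inducing a `K₄`) is strongly separating if `H - T`
has at least two connected components such that every vertex of `T` has a
neighbor in each of them. -/
def StronglySeparating {V : Type} (H : SimpleGraph V) (T : Set V) : Prop :=
  ∃ C₁ C₂ : (H.induce Tᶜ).ConnectedComponent, C₁ ≠ C₂ ∧
    ∀ v ∈ T, (∃ u ∈ C₁.supp, H.Adj v ↑u) ∧ (∃ u ∈ C₂.supp, H.Adj v ↑u)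

/-- `G` is maximal without a `K₆` minor. -/
def IsMaximalK6MinorFree {V : Type} (G : SimpleGraph V) : Prop :=
  ¬ IsMinor (⊤ : SimpleGraph (Fin 6)) G ∧
    ∀ a b : V, a ≠ b → ¬ G.Adj a b → IsMinor (⊤ : SimpleGraph (Fin 6)) (addEdge G a b)

/-! ### Explicit representation of the Petersen family -/

/-- Adjacency read off a list of neighbourhood bit masks. -/
def adjN (r : List ℕ) (i j : ℕ) : Bool := (r.getD i 0).testBit j

/-- The seven graphs of the Petersen family, as lists of neighbourhood bit masks. -/
def fam : List (List ℕ) :=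
  [[62, 61, 59, 55, 47, 31],
   [120, 120, 120, 55, 47, 31, 7],
   [60, 60, 83, 83, 111, 83, 60],
   [224, 120, 120, 166, 166, 31, 7, 25],
   [120, 120, 120, 135, 135, 135, 7, 56],
   [224, 336, 120, 388, 166, 277, 7, 25, 42],
   [224, 336, 584, 388, 642, 769, 7, 25, 42, 52]]

/-- The list `l` (in reverse order) is a partial isomorphism; test the extension by `c`. -/
def okExt (A B : ℕ → ℕ → Bool) (c : ℕ) : List ℕ → ℕ → Bool
  | [], k => A k k == B c c
  | d :: l, k => okExt A B c l k && !(d == c) && (A l.length k == B d c) && (A k l.length == B c d)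

/-- Depth first search for an isomorphism. -/
def search (m : ℕ) (A B : ℕ → ℕ → Bool) : ℕ → List ℕ → Bool
  | 0, _ => true
  | k + 1, l => (List.range m).any fun c => okExt A B c l l.length && search m A B k (c :: l)

/-- `l` (reversed) is a partial isomorphism. -/
def GoodL (m : ℕ) (A B : ℕ → ℕ → Bool) : List ℕ → Prop
  | [] => True
  | c :: l => c < m ∧ okExt A B c l l.length = true ∧ GoodL m A B l

theorem search_good (m : ℕ) (A B : ℕ → ℕ → Bool) (k : ℕ) : ∀ l, GoodL m A B l →
    search m A B k l = true → ∃ l', GoodL m A B l' ∧ l'.length = l.length + k := by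
  induction k with
  | zero => intro l hl _; exact ⟨l, hl, rfl⟩
  | succ k ih =>
    intro l hl h
    simp only [search, List.any_eq_true, List.mem_range, Bool.and_eq_true] at h
    obtain ⟨c, hc, h1, h2⟩ := h
    obtain ⟨l', h3, h4⟩ := ih (c :: l) ⟨hc, h1, hl⟩ h2
    exact ⟨l', h3, by simp at h4; omega⟩

theorem okExt_spec (A B : ℕ → ℕ → Bool) (c k : ℕ) : ∀ l, okExt A B c l k = true →
    A k k = B c c ∧ ∀ i (hi : i < l.length), l.reverse[i]'(by simpa using hi) ≠ c ∧
      A i k = B (l.reverse[i]'(by simpa using hi)) c ∧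
      A k i = B c (l.reverse[i]'(by simpa using hi)) := by
  intro l
  induction l with
  | nil => intro h; simpa [okExt] using h
  | cons d l ih =>
    intro h
    simp only [okExt, Bool.and_eq_true, beq_iff_eq, Bool.not_eq_true', beq_eq_false_iff_ne] at h
    obtain ⟨⟨⟨h1, h2⟩, h3⟩, h4⟩ := h
    refine ⟨(ih h1).1, ?_⟩
    intro i hi
    rcases Nat.lt_or_ge i l.length with hlt | hge
    · have := (ih h1).2 i hlt
      simp only [List.reverse_cons]
      rw [List.getElem_append_left (by simpa using hlt)]
      exact this
    · have hi' : i = l.length := by simp at hi; omega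
      subst hi'
      simp only [List.reverse_cons]
      rw [List.getElem_append_right (by simp)]
      simp
      exact ⟨h2, h3, h4⟩

theorem GoodL_spec (m : ℕ) (A B : ℕ → ℕ → Bool) : ∀ l, GoodL m A B l →
    ∀ i (hi : i < l.length) j (hj : j < l.length),
      l.reverse[i]'(by simpa using hi) < m ∧
      (l.reverse[i]'(by simpa using hi) = l.reverse[j]'(by simpa using hj) → i = j) ∧
      A i j = B (l.reverse[i]'(by simpa using hi)) (l.reverse[j]'(by simpa using hj)) := by
  intro l
  induction l with
  | nil => intro _ i hi; simp at hi
  | cons c l ih =>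
    intro h i hi j hj
    obtain ⟨hc, ho, hl⟩ := h
    have hs := okExt_spec A B c l.length l ho
    simp only [List.reverse_cons]
    rcases Nat.lt_or_ge i l.length with hlt | hge
    · rcases Nat.lt_or_ge j l.length with hjt | hjg
      · rw [List.getElem_append_left (by simpa using hlt), List.getElem_append_left (by simpa using hjt)]
        exact ih hl i hlt j hjt
      · have hj' : j = l.length := by simp at hj; omega
        subst hj'
        rw [List.getElem_append_left (by simpa using hlt), List.getElem_append_right (by simp)]
        simp only [List.length_reverse, Nat.sub_self, List.getElem_cons_zero]
        exact ⟨(ih hl i hlt i hlt).1, fun h => absurd h (hs.2 i hlt).1, (hs.2 i hlt).2.1⟩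
    · have hi' : i = l.length := by simp at hi; omega
      subst hi'
      rcases Nat.lt_or_ge j l.length with hjt | hjg
      · rw [List.getElem_append_right (by simp), List.getElem_append_left (by simpa using hjt)]
        simp only [List.length_reverse, Nat.sub_self, List.getElem_cons_zero]
        exact ⟨hc, fun h => absurd h.symm (hs.2 j hjt).1, (hs.2 j hjt).2.2⟩
      · have hj' : j = l.length := by simp at hj; omega
        subst hj'
        rw [List.getElem_append_right (by simp)]
        simp only [List.length_reverse, Nat.sub_self, List.getElem_cons_zero]
        exact ⟨hc, fun _ => trivial, hs.1⟩

theorem search_sound (m : ℕ) (A B : ℕ → ℕ → Bool) (h : search m A B m [] = true) :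
    ∃ σ : Fin m ≃ Fin m, ∀ u v : Fin m, A u v = B (σ u) (σ v) := by
  obtain ⟨l, hl, hlen⟩ := search_good m A B m [] trivial h
  have hlen : l.length = m := by simpa using hlen
  have hs := GoodL_spec m A B l hl
  let f : Fin m → Fin m := fun i => ⟨l.reverse[i.1]'(by simp; omega),
    (hs i (by omega) i (by omega)).1⟩
  have hf : Function.Injective f := by
    intro i j hij
    have : l.reverse[i.1]'(by simp; omega) = l.reverse[j.1]'(by simp; omega) := by
      simpa [f] using hij
    exact Fin.ext ((hs i (by omega) j (by omega)).2.1 this)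
  refine ⟨Equiv.ofBijective f (Finite.injective_iff_bijective.1 hf), fun u v => ?_⟩
  exact (hs u (by omega) v (by omega)).2.2

/-- Membership in a three element set of indices. -/
def in3 (i j k u : ℕ) : Bool := u == i || u == j || u == k

/-- Adjacency after a `∇Y`-move, the new vertex being `n`. -/
def dYb (n : ℕ) (r : List ℕ) (i j k : ℕ) (u v : ℕ) : Bool :=
  if u == n then (!(v == n) && in3 i j k v)
  else if v == n then in3 i j k u
  else adjN r u v && !(in3 i j k u && in3 i j k v)

/-- The indices skipping `v`. -/
def up (v p : ℕ) : ℕ := if p.blt v then p else p + 1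

/-- Adjacency after a `Y∇`-move at `v`. -/
def yDb (r : List ℕ) (v : ℕ) (p q : ℕ) : Bool :=
  !(p == q) && (adjN r (up v p) (up v q) || (adjN r v (up v p) && adjN r v (up v q)))

/-- Degree. -/
def degb (r : List ℕ) (v : ℕ) : ℕ := ((Finset.univ : Finset (Fin r.length)).filter
  fun u => adjN r v u.1 = true).card

def checkDY : Bool := fam.all fun r => (List.range r.length).all fun i =>
  (List.range r.length).all fun j => (List.range r.length).all fun k =>
    !(adjN r i j && adjN r j k && adjN r i k) ||
    fam.any fun r' => (r'.length == r.length + 1) &&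
      search (r.length + 1) (dYb r.length r i j k) (adjN r') (r.length + 1) []

def checkYD : Bool := fam.all fun r => (List.range r.length).all fun v =>
    !(degb r v == 3) ||
    fam.any fun r' => (r'.length + 1 == r.length) &&
      search r'.length (yDb r v) (adjN r') r'.length []

theorem checkYD_true : checkYD = true := by decide +kernel
theorem checkDY_true : checkDY = true := by decide +kernel

/-- `P` is represented by the list of bit masks `r`. -/
def MaskRep (r : List ℕ) {W : Type} (P : SimpleGraph W) : Prop :=
  ∃ e : W ≃ Fin r.length, ∀ u v, P.Adj u v ↔ adjN r (e u).1 (e v).1 = true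

theorem triangleY_some_some {W : Type} (G : SimpleGraph W) (a b c u v : W) :
    (triangleY G a b c).Adj (some u) (some v) ↔
      G.Adj u v ∧ ¬ ((u = a ∨ u = b ∨ u = c) ∧ (v = a ∨ v = b ∨ v = c)) := by
  unfold triangleY
  rw [SimpleGraph.sup_adj]
  have h1 : (SimpleGraph.map Function.Embedding.some
      (G.deleteEdges {s(a, b), s(b, c), s(a, c)})).Adj (some u) (some v) ↔
      (G.deleteEdges {s(a, b), s(b, c), s(a, c)}).Adj u v := by
    constructor
    · rintro ⟨_, p, q, h, hp, hq⟩
      simp at hp hq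
      subst hp hq
      exact h
    · intro h
      exact ⟨by simpa using h.ne, u, v, h, rfl, rfl⟩
  rw [h1]
  simp only [SimpleGraph.deleteEdges_adj, SimpleGraph.fromEdgeSet_adj, Set.mem_insert_iff,
    Set.mem_singleton_iff, Sym2.eq_iff]
  simp only [reduceCtorEq, false_and, and_false, or_false, or_self]
  constructor
  · rintro ⟨h1, h2⟩
    refine ⟨h1, ?_⟩
    have := h1.ne
    grind
  · rintro ⟨h1, h2⟩
    refine ⟨h1, ?_⟩
    grind

theorem triangleY_none_some {W : Type} (G : SimpleGraph W) (a b c v : W) :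
    (triangleY G a b c).Adj none (some v) ↔ (v = a ∨ v = b ∨ v = c) := by
  unfold triangleY
  rw [SimpleGraph.sup_adj]
  have h1 : ¬ (SimpleGraph.map Function.Embedding.some
      (G.deleteEdges {s(a, b), s(b, c), s(a, c)})).Adj none (some v) := by
    rintro ⟨_, p, q, _, hp, _⟩
    simp at hp
  simp only [h1, false_or]
  simp

theorem triangleY_some_none {W : Type} (G : SimpleGraph W) (a b c v : W) :
    (triangleY G a b c).Adj (some v) none ↔ (v = a ∨ v = b ∨ v = c) := by
  rw [SimpleGraph.adj_comm, triangleY_none_some]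

theorem in3_iff {W : Type} {n : ℕ} (e : W ≃ Fin n) (a b c u : W) :
    in3 (e a).1 (e b).1 (e c).1 (e u).1 = true ↔ (u = a ∨ u = b ∨ u = c) := by
  simp [in3, Fin.val_inj, or_assoc]

theorem rep_deltaY {W : Type} {P : SimpleGraph W} {a b c : W} {r : List ℕ} (hr : r ∈ fam)
    (h : MaskRep r P) (hab : P.Adj a b) (hbc : P.Adj b c) (hac : P.Adj a c) :
    ∃ r' ∈ fam, MaskRep r' (triangleY P a b c) := by
  obtain ⟨e, he⟩ := h
  have hc := checkDY_true
  simp only [checkDY, List.all_eq_true, List.mem_range] at hc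
  have hc := hc r hr (e a).1 (e a).2 (e b).1 (e b).2 (e c).1 (e c).2
  rw [(he a b).1 hab, (he b c).1 hbc, (he a c).1 hac] at hc
  simp only [Bool.and_self, Bool.not_true, Bool.false_or, List.any_eq_true, Bool.and_eq_true,
    beq_iff_eq] at hc
  obtain ⟨r', hr', hlen, hs⟩ := hc
  obtain ⟨σ, hσ⟩ := search_sound _ _ _ hs
  refine ⟨r', hr', ?_⟩
  let E : Option W ≃ Fin (r.length + 1) := e.optionCongr.trans finSuccEquivLast.symm
  have En : (E none).1 = r.length := by simp [E]
  have Es : ∀ w, (E (some w)).1 = (e w).1 := by intro w; simp [E]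
  refine ⟨(E.trans σ).trans (finCongr hlen.symm), ?_⟩
  intro u v
  have key : ∀ u v, (triangleY P a b c).Adj u v ↔
      dYb r.length r (e a).1 (e b).1 (e c).1 (E u).1 (E v).1 = true := by
    have hne : ∀ w, ((e w).1 == r.length) = false := by
      intro w; have := (e w).2; simp; omega
    intro u v
    rcases u with _ | u <;> rcases v with _ | v
    · simp [dYb, En]
    · rw [triangleY_none_some, En, Es]
      simp [dYb, hne, in3_iff]
    · rw [triangleY_some_none, En, Es]
      simp [dYb, hne, in3_iff]
    · rw [triangleY_some_some, Es, Es, he]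
      simp only [dYb, hne]
      simp only [Bool.false_eq_true, if_false, Bool.and_eq_true, Bool.not_eq_true',
        Bool.and_eq_false_iff]
      rw [← in3_iff e, ← in3_iff e]
      simp only [not_and_or, Bool.not_eq_true]
  rw [key, hσ]
  simp

theorem rep_yDelta {W : Type} {P : SimpleGraph W} {a b c : W} {r : List ℕ} (hr : r ∈ fam)
    (h : MaskRep r (triangleY P a b c)) (hab : P.Adj a b) (hbc : P.Adj b c) (hac : P.Adj a c) :
    ∃ r' ∈ fam, MaskRep r' P := by
  obtain ⟨e, he⟩ := h
  have hc := checkYD_true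
  simp only [checkYD, List.all_eq_true, List.mem_range] at hc
  have hc := hc r hr (e none).1 (e none).2
  have hN : ∀ w : W, adjN r (e none).1 (e (some w)).1 = true ↔ (w = a ∨ w = b ∨ w = c) := by
    intro w
    rw [← he, triangleY_none_some]
  have hdeg : degb r (e none).1 = 3 := by
    have : ((Finset.univ : Finset (Fin r.length)).filter
        fun u => adjN r (e none).1 u.1 = true) = {e (some a), e (some b), e (some c)} := by
      ext u
      obtain ⟨w, rfl⟩ := e.surjective u
      rcases w with _ | w
      · have := (he none none)
        simp at this
        simp [this]
      · simp [hN]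
    unfold degb
    rw [this, Finset.card_eq_three]
    exact ⟨_, _, _, by simpa using hab.ne, by simpa using hac.ne, by simpa using hbc.ne, rfl⟩
  rw [hdeg] at hc
  simp only [beq_self_eq_true, Bool.not_true, Bool.false_or, List.any_eq_true, Bool.and_eq_true,
    beq_iff_eq] at hc
  obtain ⟨r', hr', hlen, hs⟩ := hc
  obtain ⟨σ, hσ⟩ := search_sound _ _ _ hs
  refine ⟨r', hr', ?_⟩
  let e' : Option W ≃ Fin (r'.length + 1) := e.trans (finCongr hlen.symm)
  have hex : ∀ w : W, ∃ p : Fin r'.length, (e' none).succAbove p = e' (some w) := by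
    intro w
    apply Fin.exists_succAbove_eq
    simp
  choose g hg using hex
  have hginj : Function.Injective g := by
    intro u v huv
    have h1 := hg u
    rw [huv, hg v] at h1
    simpa using h1.symm
  have hgsurj : Function.Surjective g := by
    intro p
    obtain ⟨w, hw⟩ := e'.surjective ((e' none).succAbove p)
    rcases w with _ | w
    · exact absurd hw.symm (Fin.succAbove_ne _ _)
    · refine ⟨w, ?_⟩
      have h1 := hg w
      rw [hw] at h1
      exact Fin.succAbove_right_injective h1
  have hup : ∀ w, up (e none).1 (g w).1 = (e (some w)).1 := by
    intro w
    have h1 : (e' (some w)).1 = (e (some w)).1 := by simp [e']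
    have h2 : (e' none).1 = (e none).1 := by simp [e']
    rw [← h1, ← hg w, ← h2]
    unfold up Fin.succAbove
    simp only [Fin.lt_def, Nat.blt_eq, Fin.val_castSucc]
    split_ifs <;> simp
  let E := Equiv.ofBijective g ⟨hginj, hgsurj⟩
  refine ⟨E.trans σ, fun u v => ?_⟩
  have : yDb r (e none).1 (g u).1 (g v).1 = true ↔ P.Adj u v := by
    simp only [yDb, hup, Bool.and_eq_true, Bool.or_eq_true, hN, ← he, triangleY_some_some]
    simp only [Bool.not_eq_true', beq_eq_false_iff_ne, ne_eq, Fin.val_inj, hginj.eq_iff]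
    have := hab.symm; have := hac.symm; have := hbc.symm
    constructor
    · rintro ⟨h1, h2 | h2⟩
      · exact h2.1
      · grind
    · intro h
      refine ⟨h.ne, ?_⟩
      tauto
  rw [← this, hσ]
  exact Iff.rfl

theorem rep_k6 : MaskRep [62, 61, 59, 55, 47, 31] (⊤ : SimpleGraph (Fin 6)) := by
  refine ⟨Equiv.refl _, ?_⟩
  decide

theorem rep_of_family {W : Type} {P : SimpleGraph W} (h : IsPetersenFamily P) :
    ∃ r ∈ fam, MaskRep r P := by
  induction h with
  | k6 => exact ⟨_, by simp [fam], rep_k6⟩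
  | deltaY _ h1 h2 h3 ih =>
    obtain ⟨r, hr, h⟩ := ih
    exact rep_deltaY hr h h1 h2 h3
  | yDelta _ h1 h2 h3 ih =>
    obtain ⟨r, hr, h⟩ := ih
    exact rep_yDelta hr h h1 h2 h3
  | iso _ φ ih =>
    obtain ⟨r, hr, e, he⟩ := ih
    refine ⟨r, hr, φ.symm.toEquiv.trans e, fun u v => ?_⟩
    rw [← φ.symm.map_adj_iff, he]
    rfl

/-! ### Small vertex cuts of the graphs of the Petersen family -/

/-- One round of closing up the set `Y` under adjacency outside the set `m`. -/
def stepM (r : List ℕ) (m : ℕ) (us : List ℕ) (Y : ℕ) : ℕ :=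
  us.foldl (fun Y u => if Y.testBit u && !m.testBit u then Y ||| r.getD u 0 else Y) Y

/-- The closure after `k` rounds. -/
def closM (r : List ℕ) (m : ℕ) : ℕ → ℕ → ℕ
  | 0, Y => Y
  | k + 1, Y => closM r m k (stepM r m (List.range r.length) Y)

theorem stepM_inv (r : List ℕ) (m : ℕ) (Lp : ℕ → Prop)
    (hL : ∀ u v, u < r.length → v < r.length → Lp u → m.testBit u = false → adjN r u v = true →
      m.testBit v = true ∨ Lp v) :
    ∀ us : List ℕ, (∀ u ∈ us, u < r.length) → ∀ Y : ℕ,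
      (∀ i, i < r.length → Y.testBit i = true → m.testBit i = true ∨ Lp i) →
      (∀ i, i < r.length → (stepM r m us Y).testBit i = true → m.testBit i = true ∨ Lp i) := by
  intro us
  induction us with
  | nil => intro _ Y h; exact h
  | cons u us ih =>
    intro hus Y h
    have : stepM r m (u :: us) Y =
      stepM r m us (if Y.testBit u && !m.testBit u then Y ||| r.getD u 0 else Y) := rfl
    rw [this]
    apply ih (fun v hv => hus v (by simp [hv]))
    split_ifs with hc
    · intro i hi hb
      rw [Nat.testBit_or, Bool.or_eq_true] at hb
      rcases hb with hb | hb
      · exact h i hi hb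
      · have hu : u < r.length := hus u (by simp)
        simp only [Bool.and_eq_true, Bool.not_eq_true'] at hc
        have := h u hu hc.1
        rw [hc.2] at this
        exact hL u i hu hi (by simpa using this) hc.2 hb
    · exact h

theorem closM_inv (r : List ℕ) (m : ℕ) (Lp : ℕ → Prop)
    (hL : ∀ u v, u < r.length → v < r.length → Lp u → m.testBit u = false → adjN r u v = true →
      m.testBit v = true ∨ Lp v) (k : ℕ) : ∀ Y : ℕ,
      (∀ i, i < r.length → Y.testBit i = true → m.testBit i = true ∨ Lp i) →
      (∀ i, i < r.length → (closM r m k Y).testBit i = true → m.testBit i = true ∨ Lp i) := by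
  induction k with
  | zero => intro Y h; exact h
  | succ k ih =>
    intro Y h
    exact ih _ (stepM_inv r m Lp hL _ (by simp) Y h)

/-- The complement of `m` is connected. -/
def connM (r : List ℕ) (m : ℕ) : Bool := (List.range r.length).any fun v =>
  !m.testBit v &&
    (List.range r.length).all fun i => m.testBit i || (closM r m r.length (2 ^ v)).testBit i

/-- Some vertex of degree three outside `m` has its neighbours, pairwise nonadjacent, in `m`. -/
def degM (r : List ℕ) (m : ℕ) : Bool := (List.range r.length).any fun v => !m.testBit v &&
  (List.range r.length).any fun a => (m.testBit a && adjN r v a) &&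
  (List.range r.length).any fun b => (m.testBit b && adjN r v b && !(a == b) && !adjN r a b) &&
  (List.range r.length).any fun c => (m.testBit c && adjN r v c && !(a == c) && !(b == c) &&
    !adjN r a c && !adjN r b c) &&
  (List.range r.length).all fun u => !adjN r v u || in3 a b c u

/-- The vertex or edge `pq` outside `m` is adjacent to all of `m`. -/
def fullM (r : List ℕ) (m : ℕ) (p q : ℕ) : Bool :=
  !m.testBit p && !m.testBit q && (p == q || adjN r p q) &&
    (List.range r.length).all fun a => !m.testBit a || adjN r p a || adjN r q a

/-- The pairs `pq` as above. -/
def pairsM (r : List ℕ) (m : ℕ) : List (ℕ × ℕ) :=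
  ((List.range r.length).flatMap fun p => (List.range r.length).map fun q => (p, q)).filter
    fun x => fullM r m x.1 x.2

/-- Disjointness of pairs. -/
def disjM (x y : ℕ × ℕ) : Bool := !(x.1 == y.1) && !(x.1 == y.2) && !(x.2 == y.1) && !(x.2 == y.2)

/-- Three disjoint full vertices or edges. -/
def threeM (l : List (ℕ × ℕ)) : Bool :=
  l.any fun x => l.any fun y => disjM x y && l.any fun z => disjM x z && disjM y z

/-- The number of elements of `m`. -/
def popM (n m : ℕ) : ℕ := ((Finset.univ : Finset (Fin n)).filter fun i => m.testBit i.1 = true).card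

/-- The check for one cut set. -/
def cutM (r : List ℕ) (m : ℕ) : Bool :=
  Nat.blt 4 (popM r.length m) || degM r m || connM r m ||
    (popM r.length m == 4 && threeM (pairsM r m))

def checkCut : Bool := fam.all fun r => (List.range (2 ^ r.length)).all fun m => cutM r m

theorem checkCut_true : checkCut = true := by decide +kernel

theorem cut_claim {W : Type} {P : SimpleGraph W} (hP : IsPetersenFamily P) (A L : Set W)
    (hL : ∃ l, l ∈ L ∧ l ∉ A) (hR : ∃ l, l ∉ L ∧ l ∉ A)
    (hLR : ∀ u v, u ∉ A → v ∉ A → P.Adj u v → (u ∈ L ↔ v ∈ L)) (hA : A.ncard ≤ 4) :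
    (∃ v a b c, v ∉ A ∧ a ∈ A ∧ b ∈ A ∧ c ∈ A ∧ a ≠ b ∧ a ≠ c ∧ b ≠ c ∧
      ¬ P.Adj a b ∧ ¬ P.Adj a c ∧ ¬ P.Adj b c ∧ ∀ u, P.Adj v u ↔ (u = a ∨ u = b ∨ u = c)) ∨
    (A.ncard = 4 ∧ ∃ K : Fin 3 → W × W, (∀ j, (K j).1 ∉ A ∧ (K j).2 ∉ A ∧
      ((K j).1 = (K j).2 ∨ P.Adj (K j).1 (K j).2) ∧
      ∀ a ∈ A, P.Adj (K j).1 a ∨ P.Adj (K j).2 a) ∧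
      ∀ i j, i ≠ j → (K i).1 ≠ (K j).1 ∧ (K i).1 ≠ (K j).2 ∧ (K i).2 ≠ (K j).1 ∧
        (K i).2 ≠ (K j).2) := by
  classical
  obtain ⟨r, hr, e, he⟩ := rep_of_family hP
  let m : ℕ := Nat.ofBits (n := r.length) fun i => decide (e.symm i ∈ A)
  have hm : ∀ w, m.testBit (e w).1 = true ↔ w ∈ A := by
    intro w
    rw [Nat.testBit_ofBits_lt _ _ (e w).2]
    simp
  have hmf : ∀ w, m.testBit (e w).1 = false ↔ w ∉ A := by
    intro w
    rw [← hm, Bool.not_eq_true]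
  have hmlt : m < 2 ^ r.length := Nat.ofBits_lt_two_pow _
  have hpop : popM r.length m = A.ncard := by
    have : A = ((Finset.univ.filter fun i : Fin r.length => m.testBit i.1 = true).map
        e.symm.toEmbedding : Finset W) := by
      ext w
      simp [hm]
    rw [this, Set.ncard_coe_finset, Finset.card_map]
    rfl
  have hc := checkCut_true
  simp only [checkCut, List.all_eq_true, List.mem_range] at hc
  have hc := hc r hr m hmlt
  have lift : ∀ i, i < r.length → ∃ w, (e w).1 = i := fun i hi => ⟨e.symm ⟨i, hi⟩, by simp⟩
  simp only [cutM, Bool.or_eq_true, Bool.and_eq_true] at hc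
  rcases hc with ((hc | hc) | hc) | ⟨hc1, hc2⟩
  · rw [hpop, Nat.blt_eq] at hc
    omega
  · left
    simp only [degM, List.any_eq_true, List.mem_range, Bool.and_eq_true, Bool.not_eq_true',
      beq_eq_false_iff_ne, List.all_eq_true, Bool.or_eq_true] at hc
    obtain ⟨v, hv, hv1, a, ha, ha1, b, hb, hb1, c, hc, hc1, hall⟩ := hc
    obtain ⟨v, rfl⟩ := lift v hv
    obtain ⟨a, rfl⟩ := lift a ha
    obtain ⟨b, rfl⟩ := lift b hb
    obtain ⟨c, rfl⟩ := lift c hc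
    simp only [hm, hmf, ← he, ← Bool.not_eq_true, ne_eq, Fin.val_inj, e.injective.eq_iff]
      at hv1 ha1 hb1 hc1
    refine ⟨v, a, b, c, hv1, ha1.1, hb1.1.1.1, hc1.1.1.1.1.1, hb1.1.2, hc1.1.1.1.2, hc1.1.1.2,
      hb1.2, hc1.1.2, hc1.2, fun u => ?_⟩
    constructor
    · intro h
      have := hall (e u).1 (e u).2
      rw [in3_iff] at this
      rcases this with this | this
      · rw [← Bool.not_eq_true, ← he] at this
        exact absurd h this
      · exact this
    · rintro (rfl | rfl | rfl)
      · exact ha1.2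
      · exact hb1.1.1.2
      · exact hc1.1.1.1.1.2
  · exfalso
    simp only [connM, List.any_eq_true, List.mem_range, Bool.and_eq_true, Bool.not_eq_true',
      List.all_eq_true, Bool.or_eq_true] at hc
    obtain ⟨v, hv, hv1, hall⟩ := hc
    obtain ⟨v, rfl⟩ := lift v hv
    have key : ∀ X : Set W, (∀ u v, u ∉ A → v ∉ A → P.Adj u v → u ∈ X → v ∈ X) → v ∈ X →
        ∀ w, w ∉ A → w ∈ X := by
      intro X hX hvX w hw
      have := closM_inv r m (fun i => ∃ w, (e w).1 = i ∧ w ∈ X) (by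
        intro p q hp hq hpX hpm hpq
        obtain ⟨p, rfl⟩ := lift p hp
        obtain ⟨q, rfl⟩ := lift q hq
        rw [← he] at hpq
        rw [hmf] at hpm
        rw [hm]
        by_cases hqA : q ∈ A
        · exact Or.inl hqA
        · right
          obtain ⟨p', hp', hp''⟩ := hpX
          have : p' = p := e.injective (Fin.ext hp')
          subst this
          exact ⟨q, rfl, hX _ _ hpm hqA hpq hp''⟩) r.length (2 ^ (e v).1) (by
        intro i hi hb
        rw [Nat.testBit_two_pow] at hb
        right
        exact ⟨v, by simpa using hb, hvX⟩) (e w).1 (e w).2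
      rcases hall (e w).1 (e w).2 with h | h
      · exact absurd ((hm w).1 h) hw
      · rcases this h with h | ⟨w', h1, h2⟩
        · exact absurd ((hm w).1 h) hw
        · have : w' = w := e.injective (Fin.ext h1)
          rwa [← this]
    obtain ⟨l, hl, hlA⟩ := hL
    obtain ⟨k, hk, hkA⟩ := hR
    by_cases hvL : v ∈ L
    · exact hk (key L (fun u v hu hv huv h => (hLR u v hu hv huv).1 h) hvL k hkA)
    · exact key Lᶜ (fun u v hu hv huv h h' => h ((hLR u v hu hv huv).2 h')) hvL l hlA hl
  · right
    rw [hpop, beq_iff_eq] at hc1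
    refine ⟨hc1, ?_⟩
    simp only [threeM, List.any_eq_true, Bool.and_eq_true, disjM, Bool.not_eq_true',
      beq_eq_false_iff_ne] at hc2
    obtain ⟨x, hx, y, hy, hxy, z, hz, hxz, hyz⟩ := hc2
    have hpair : ∀ x ∈ pairsM r m, ∃ k : W × W, ((e k.1).1, (e k.2).1) = x ∧
        (k.1 ∉ A ∧ k.2 ∉ A ∧ (k.1 = k.2 ∨ P.Adj k.1 k.2) ∧
          ∀ a ∈ A, P.Adj k.1 a ∨ P.Adj k.2 a) := by
      rintro ⟨p, q⟩ hx
      simp only [pairsM, List.mem_filter, List.mem_flatMap, List.mem_map, List.mem_range,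
        Prod.mk.injEq] at hx
      obtain ⟨⟨p', hp, q', hq, rfl, rfl⟩, hf⟩ := hx
      obtain ⟨p, rfl⟩ := lift p' hp
      obtain ⟨q, rfl⟩ := lift q' hq
      simp only [fullM, Bool.and_eq_true, Bool.not_eq_true', Bool.or_eq_true, beq_iff_eq,
        List.all_eq_true, List.mem_range, hmf, ← he, Fin.val_inj, e.injective.eq_iff] at hf
      refine ⟨(p, q), rfl, hf.1.1.1, hf.1.1.2, hf.1.2, fun a ha => ?_⟩
      have := hf.2 (e a).1 (e a).2
      simp only [hmf, ← he] at this
      rcases this with (h | h) | h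
      · exact absurd ha h
      · exact Or.inl h
      · exact Or.inr h
    obtain ⟨k0, rfl, h0⟩ := hpair x hx
    obtain ⟨k1, rfl, h1⟩ := hpair y hy
    obtain ⟨k2, rfl, h2⟩ := hpair z hz
    simp only [ne_eq, Fin.val_inj, e.injective.eq_iff] at hxy hxz hyz
    refine ⟨![k0, k1, k2], ?_, ?_⟩
    · intro j
      fin_cases j
      · exact h0
      · exact h1
      · exact h2
    · intro i j hij
      fin_cases i <;> fin_cases j <;> simp at hij ⊢ <;> grind

/-! ### Connected sets of vertices -/

/-- `X` is nonempty and connected, phrased by closed subsets. -/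
def Conn {V : Type} (G : SimpleGraph V) (X : Set V) : Prop :=
  X.Nonempty ∧ ∀ Y : Set V, (∃ u ∈ X, u ∈ Y) →
    (∀ u ∈ X, u ∈ Y → ∀ v ∈ X, G.Adj u v → v ∈ Y) → X ⊆ Y

theorem conn_iff {V : Type} (G : SimpleGraph V) (X : Set V) :
    (G.induce X).Connected ↔ Conn G X := by
  constructor
  · intro h
    obtain ⟨⟨x, hx⟩⟩ := h.nonempty
    refine ⟨⟨x, hx⟩, ?_⟩
    rintro Y ⟨u, hu, huY⟩ hc v hv
    have hr := h.preconnected ⟨u, hu⟩ ⟨v, hv⟩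
    rw [SimpleGraph.reachable_iff_reflTransGen] at hr
    have : ∀ w : X, Relation.ReflTransGen (G.induce X).Adj ⟨u, hu⟩ w → w.1 ∈ Y := by
      intro w hw
      induction hw with
      | refl => exact huY
      | tail _ h2 ih => exact hc _ (Subtype.property _) ih _ (Subtype.property _) h2
    exact this _ hr
  · rintro ⟨⟨x, hx⟩, h⟩
    have : Nonempty X := ⟨⟨x, hx⟩⟩
    refine ⟨fun u v => ?_⟩
    have := h {w | ∃ hw : w ∈ X, (G.induce X).Reachable u ⟨w, hw⟩} ⟨u, u.2, u.2, Reachable.refl _⟩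
      (by
        rintro p hp ⟨hp', hr⟩ q hq hpq
        refine ⟨hq, hr.trans (Adj.reachable ?_)⟩
        exact hpq) v.2
    exact this.2

theorem conn_singleton {V : Type} (G : SimpleGraph V) (a : V) : Conn G {a} := by
  refine ⟨⟨a, rfl⟩, ?_⟩
  rintro Y ⟨u, rfl, h⟩ _ v rfl
  exact h

theorem conn_mono {V : Type} {G H : SimpleGraph V} (hGH : G ≤ H) {X : Set V} (h : Conn G X) :
    Conn H X :=
  ⟨h.1, fun Y hY hc => h.2 Y hY fun u hu huY v hv huv => hc u hu huY v hv (hGH huv)⟩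

theorem conn_biUnion {V V' : Type} {G : SimpleGraph V} {H : SimpleGraph V'} {X : Set V'}
    (hX : Conn H X) (g : V' → Set V) (hg : ∀ u ∈ X, Conn G (g u))
    (he : ∀ u ∈ X, ∀ v ∈ X, H.Adj u v → ∃ p ∈ g u, ∃ q ∈ g v, G.Adj p q) :
    Conn G (⋃ u ∈ X, g u) := by
  obtain ⟨x, hx⟩ := hX.1
  obtain ⟨p, hp⟩ := (hg x hx).1
  refine ⟨⟨p, by simp; exact ⟨x, hx, hp⟩⟩, ?_⟩
  rintro Y ⟨q, hq, hqY⟩ hc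
  simp only [Set.mem_iUnion, exists_prop] at hq hc
  have hsub : ∀ u ∈ X, (∃ q ∈ g u, q ∈ Y) → g u ⊆ Y := by
    intro u hu hq
    exact (hg u hu).2 Y hq fun a ha haY b hb hab => hc a ⟨u, hu, ha⟩ haY b ⟨u, hu, hb⟩ hab
  obtain ⟨u, hu, hqu⟩ := hq
  have := hX.2 {v | v ∈ X ∧ g v ⊆ Y} ⟨u, hu, hu, hsub u hu ⟨q, hqu, hqY⟩⟩ (by
    rintro a ha ⟨_, haY⟩ b hb hab
    obtain ⟨p, hp, q, hq, hpq⟩ := he a ha b hb hab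
    exact ⟨hb, hsub b hb ⟨q, hq, hc p ⟨a, ha, hp⟩ (haY hp) q ⟨b, hb, hq⟩ hpq⟩⟩)
  intro v hv
  simp only [Set.mem_iUnion, exists_prop] at hv
  obtain ⟨w, hw, hvw⟩ := hv
  exact (this hw).2 hvw

theorem conn_union {V : Type} {G : SimpleGraph V} {X Y : Set V} (hX : Conn G X) (hY : Conn G Y)
    (h : ∃ a ∈ X, ∃ b ∈ Y, G.Adj a b) : Conn G (X ∪ Y) := by
  obtain ⟨a, ha, b, hb, hab⟩ := h
  refine ⟨⟨a, Or.inl ha⟩, ?_⟩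
  rintro Z ⟨u, hu, huZ⟩ hc
  have h1 : (∃ u ∈ X, u ∈ Z) → X ⊆ Z := fun h => hX.2 Z h
    fun p hp hpZ q hq hpq => hc p (Or.inl hp) hpZ q (Or.inl hq) hpq
  have h2 : (∃ u ∈ Y, u ∈ Z) → Y ⊆ Z := fun h => hY.2 Z h
    fun p hp hpZ q hq hpq => hc p (Or.inr hp) hpZ q (Or.inr hq) hpq
  rcases hu with hu | hu
  · have hXZ := h1 ⟨u, hu, huZ⟩
    exact Set.union_subset hXZ (h2 ⟨b, hb, hc a (Or.inl ha) (hXZ ha) b (Or.inr hb) hab⟩)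
  · have hYZ := h2 ⟨u, hu, huZ⟩
    exact Set.union_subset (h1 ⟨a, ha, hc b (Or.inr hb) (hYZ hb) a (Or.inl ha) hab.symm⟩) hYZ

/-- Adding to a connected set a family of connected sets, each of which is attached to it. -/
theorem conn_union_iUnion {V ι : Type} {G : SimpleGraph V} {X : Set V} (hX : Conn G X)
    (D : ι → Set V) (hD : ∀ i, (D i).Nonempty → Conn G (D i) ∧ ∃ a ∈ X, ∃ b ∈ D i, G.Adj a b) :
    Conn G (X ∪ ⋃ i, D i) := by
  obtain ⟨x, hx⟩ := hX.1
  refine ⟨⟨x, Or.inl hx⟩, ?_⟩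
  rintro Z ⟨u, hu, huZ⟩ hc
  have hDX : ∀ i, D i ⊆ X ∪ ⋃ i, D i := fun i v hv => Or.inr (Set.mem_iUnion.2 ⟨i, hv⟩)
  have h1 : (∃ u ∈ X, u ∈ Z) → X ⊆ Z := fun h => hX.2 Z h
    fun p hp hpZ q hq hpq => hc p (Or.inl hp) hpZ q (Or.inl hq) hpq
  have h2 : ∀ i, (∃ u ∈ D i, u ∈ Z) → D i ⊆ Z := fun i h => by
    obtain ⟨d, hd, _⟩ := id h
    exact (hD i ⟨d, hd⟩).1.2 Z h
      fun p hp hpZ q hq hpq => hc p (hDX i hp) hpZ q (hDX i hq) hpq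
  have h3 : X ⊆ Z := by
    rcases hu with hu | hu
    · exact h1 ⟨u, hu, huZ⟩
    · obtain ⟨i, hi⟩ := Set.mem_iUnion.1 hu
      obtain ⟨a, ha, b, hb, hab⟩ := (hD i ⟨u, hi⟩).2
      exact h1 ⟨a, ha, hc b (hDX i hb) (h2 i ⟨u, hi, huZ⟩ hb) a (Or.inl ha) hab.symm⟩
  refine Set.union_subset h3 (Set.iUnion_subset fun i v hv => ?_)
  obtain ⟨a, ha, b, hb, hab⟩ := (hD i ⟨v, hv⟩).2
  exact h2 i ⟨b, hb, hc a (Or.inl ha) (h3 ha) b (hDX i hb) hab⟩ hv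

/-- `C` is a connected component of the subgraph induced by `U`. -/
def IsComp {V : Type} (G : SimpleGraph V) (U C : Set V) : Prop :=
  Conn G C ∧ C ⊆ U ∧ ∀ u ∈ C, ∀ v ∈ U, G.Adj u v → v ∈ C

theorem exists_comp {V : Type} (G : SimpleGraph V) (U : Set V) (u : V) (hu : u ∈ U) :
    ∃ C, IsComp G U C ∧ u ∈ C := by
  let C : Set V := {v | v ∈ U ∧ ∀ Y : Set V, u ∈ Y →
    (∀ a ∈ Y, a ∈ U → ∀ b ∈ U, G.Adj a b → b ∈ Y) → v ∈ Y}
  have huC : u ∈ C := ⟨hu, fun Y h _ => h⟩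
  have hcl : ∀ a ∈ C, ∀ b ∈ U, G.Adj a b → b ∈ C := by
    rintro a ⟨haU, ha⟩ b hb hab
    exact ⟨hb, fun Y hY hc => hc a (ha Y hY hc) haU b hb hab⟩
  refine ⟨C, ⟨⟨⟨u, huC⟩, ?_⟩, fun v hv => hv.1, hcl⟩, huC⟩
  rintro Y ⟨w, hw, hwY⟩ hc v hv
  by_cases huY : u ∈ Y
  · have := hv.2 (Y ∩ C) ⟨huY, huC⟩ (by
      rintro a ⟨haY, haC⟩ haU b hb hab
      have hbC := hcl a haC b hb hab
      exact ⟨hc a haC haY b hbC hab, hbC⟩)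
    exact this.1
  · have := hw.2 (C \ Y) ⟨huC, huY⟩ (by
      rintro a ⟨haC, haY⟩ haU b hb hab
      have hbC := hcl a haC b hb hab
      exact ⟨hbC, fun hbY => haY (hc b hbC hbY a haC hab.symm)⟩)
    exact absurd hwY this.2

/-- A connected set meeting a component is contained in it. -/
theorem IsComp.subset {V : Type} {G : SimpleGraph V} {U C X : Set V} (h : IsComp G U C)
    (hX : Conn G X) (hXU : X ⊆ U) (hm : ∃ u ∈ X, u ∈ C) : X ⊆ C :=
  hX.2 C hm fun _ _ huC v hv huv => h.2.2 _ huC v (hXU hv) huv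

theorem IsComp.eq {V : Type} {G : SimpleGraph V} {U C D : Set V} (h : IsComp G U C)
    (h' : IsComp G U D) (hm : ∃ u ∈ C, u ∈ D) : C = D := by
  obtain ⟨u, hu, hv⟩ := hm
  exact Set.Subset.antisymm (h'.subset h.1 h.2.1 ⟨u, hu, hv⟩) (h.subset h'.1 h'.2.1 ⟨u, hv, hu⟩)

theorem conn_image_val {V : Type} {G : SimpleGraph V} {U : Set V} {X : Set U} :
    Conn (G.induce U) X ↔ Conn G (Subtype.val '' X) := by
  constructor
  · intro h
    have := conn_biUnion (G := G) h (fun u => {u.1}) (fun u _ => conn_singleton G _)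
      (fun u _ v _ huv => ⟨_, rfl, _, rfl, huv⟩)
    convert this using 1
    ext v
    simp
  · rintro ⟨⟨_, ⟨x, hx, rfl⟩⟩, h⟩
    refine ⟨⟨x, hx⟩, ?_⟩
    rintro Y ⟨u, hu, huY⟩ hc v hv
    have := h (Subtype.val '' Y) ⟨u, ⟨u, hu, rfl⟩, ⟨u, huY, rfl⟩⟩ (by
      rintro _ ⟨a, ha, rfl⟩ ⟨a', ha', haa⟩ _ ⟨b, hb, rfl⟩ hab
      have : a' = a := Subtype.ext haa
      subst this
      exact ⟨b, hc a' ha ha' b hb hab, rfl⟩) ⟨v, hv, rfl⟩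
    obtain ⟨w, hw, hwv⟩ := this
    rwa [← Subtype.ext hwv]

/-! ### Minors inside a set of vertices -/

/-- `P` is a minor of the subgraph of `G` induced by `U`. -/
def MinorOn {W V : Type} (P : SimpleGraph W) (G : SimpleGraph V) (U : Set V) : Prop :=
  ∃ f : W → Set V, (∀ w, f w ⊆ U) ∧ (∀ w, Conn G (f w)) ∧
    (∀ w w', w ≠ w' → ∀ v, v ∈ f w → v ∉ f w') ∧
    ∀ w w', P.Adj w w' → ∃ v ∈ f w, ∃ v' ∈ f w', G.Adj v v'

theorem isMinor_iff {W V : Type} (P : SimpleGraph W) (G : SimpleGraph V) :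
    IsMinor P G ↔ MinorOn P G Set.univ := by
  constructor
  · rintro ⟨f, h1, h2, h3, h4⟩
    exact ⟨f, fun w => Set.subset_univ _, fun w => (conn_iff G _).1 (h2 w),
      fun w w' hw v hv hv' => Set.disjoint_left.1 (h3 hw) hv hv', fun w w' h => h4 h⟩
  · rintro ⟨f, h1, h2, h3, h4⟩
    exact ⟨f, fun w => (h2 w).1, fun w => (conn_iff G _).2 (h2 w),
      fun w w' hw => Set.disjoint_left.2 fun v hv => h3 w w' hw v hv, fun w w' h => h4 w w' h⟩

theorem isMinor_induce_iff {W V : Type} (P : SimpleGraph W) (G : SimpleGraph V) (U : Set V) :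
    IsMinor P (G.induce U) ↔ MinorOn P G U := by
  rw [isMinor_iff]
  constructor
  · rintro ⟨f, h1, h2, h3, h4⟩
    refine ⟨fun w => Subtype.val '' f w, fun w => by simp, fun w => conn_image_val.1 (h2 w), ?_, ?_⟩
    · rintro w w' hw _ ⟨v, hv, rfl⟩ ⟨v', hv', hvv⟩
      have := Subtype.ext hvv
      subst this
      exact h3 w w' hw v' hv hv'
    · intro w w' h
      obtain ⟨v, hv, v', hv', hvv⟩ := h4 w w' h
      exact ⟨v, ⟨v, hv, rfl⟩, v', ⟨v', hv', rfl⟩, hvv⟩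
  · rintro ⟨f, h1, h2, h3, h4⟩
    refine ⟨fun w => Subtype.val ⁻¹' f w, fun w => Set.subset_univ _, fun w => ?_, ?_, ?_⟩
    · rw [conn_image_val, Subtype.image_preimage_coe, Set.inter_eq_right.2 (h1 w)]
      exact h2 w
    · intro w w' hw v hv
      exact h3 w w' hw v hv
    · intro w w' h
      obtain ⟨v, hv, v', hv', hvv⟩ := h4 w w' h
      exact ⟨⟨v, h1 w hv⟩, hv, ⟨v', h1 w' hv'⟩, hv', hvv⟩

theorem MinorOn.trans {W V V' : Type} {P : SimpleGraph W} {G : SimpleGraph V}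
    {H : SimpleGraph V'} {U : Set V} {U' : Set V'} (h : MinorOn P H U') (g : V' → Set V)
    (h1 : ∀ u ∈ U', g u ⊆ U) (h2 : ∀ u ∈ U', Conn G (g u))
    (h3 : ∀ u ∈ U', ∀ u' ∈ U', u ≠ u' → ∀ v, v ∈ g u → v ∉ g u')
    (h4 : ∀ u ∈ U', ∀ u' ∈ U', H.Adj u u' → ∃ v ∈ g u, ∃ v' ∈ g u', G.Adj v v') :
    MinorOn P G U := by
  obtain ⟨f, f1, f2, f3, f4⟩ := h
  refine ⟨fun w => ⋃ u ∈ f w, g u, ?_, ?_, ?_, ?_⟩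
  · intro w
    exact Set.iUnion₂_subset fun u hu => h1 u (f1 w hu)
  · intro w
    exact conn_biUnion (f2 w) g (fun u hu => h2 u (f1 w hu))
      (fun u hu v hv huv => h4 u (f1 w hu) v (f1 w hv) huv)
  · intro w w' hw v hv hv'
    simp only [Set.mem_iUnion, exists_prop] at hv hv'
    obtain ⟨u, hu, huv⟩ := hv
    obtain ⟨u', hu', huv'⟩ := hv'
    have : u ≠ u' := by
      rintro rfl
      exact f3 w w' hw u hu hu'
    exact h3 u (f1 w hu) u' (f1 w' hu') this v huv huv'
  · intro w w' h
    obtain ⟨u, hu, u', hu', huu⟩ := f4 w w' h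
    obtain ⟨v, hv, v', hv', hvv⟩ := h4 u (f1 w hu) u' (f1 w' hu') huu
    refine ⟨v, ?_, v', ?_, hvv⟩
    · simp only [Set.mem_iUnion, exists_prop]; exact ⟨u, hu, hv⟩
    · simp only [Set.mem_iUnion, exists_prop]; exact ⟨u', hu', hv'⟩

theorem MinorOn.mono {W V : Type} {P : SimpleGraph W} {G H : SimpleGraph V} {U U' : Set V}
    (h : MinorOn P G U) (hU : U ⊆ U') (hG : ∀ u ∈ U, ∀ v ∈ U, G.Adj u v → H.Adj u v) :
    MinorOn P H U' :=
  h.trans (fun u => {u}) (fun u hu => by simpa using hU hu) (fun u _ => conn_singleton _ _)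
    (fun u _ u' _ hu v hv hv' => hu (by simp at hv hv'; rw [← hv, ← hv']))
    (fun u hu u' hu' huu => ⟨u, rfl, u', rfl, hG u hu u' hu' huu⟩)

/-- No minor of the Petersen family inside `U`. -/
def LinkOn {V : Type} (G : SimpleGraph V) (U : Set V) : Prop :=
  ∀ ⦃W : Type⦄ (P : SimpleGraph W), IsPetersenFamily P → ¬ MinorOn P G U

theorem isLinkless_iff {V : Type} (G : SimpleGraph V) : IsLinkless G ↔ LinkOn G Set.univ := by
  unfold IsLinkless LinkOn
  simp only [isMinor_iff]

theorem isLinkless_induce_iff {V : Type} (G : SimpleGraph V) (U : Set V) :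
    IsLinkless (G.induce U) ↔ LinkOn G U := by
  unfold IsLinkless LinkOn
  simp only [isMinor_induce_iff]

theorem addEdge_adj {V : Type} (G : SimpleGraph V) (a b u v : V) :
    (addEdge G a b).Adj u v ↔ G.Adj u v ∨ (u ≠ v ∧ ((u = a ∧ v = b) ∨ (u = b ∧ v = a))) := by
  unfold addEdge
  rw [SimpleGraph.sup_adj, SimpleGraph.fromEdgeSet_adj, Set.mem_singleton_iff, Sym2.eq_iff]
  tauto

theorem addEdge_comm {V : Type} (G : SimpleGraph V) (a b : V) : addEdge G a b = addEdge G b a := by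
  unfold addEdge
  rw [Sym2.eq_swap]

theorem addEdge_induce {V : Type} (G : SimpleGraph V) (U : Set V) (a b : U) :
    addEdge (G.induce U) a b = (addEdge G a.1 b.1).induce U := by
  ext u v
  rw [addEdge_adj]
  simp only [SimpleGraph.comap_adj, Function.Embedding.subtype_apply, addEdge_adj, ne_eq,
    Subtype.ext_iff]

/-! ### Some members of the Petersen family -/

instance triangleYDec {V : Type} [DecidableEq V] (G : SimpleGraph V) [DecidableRel G.Adj]
    (a b c : V) : DecidableRel (triangleY G a b c).Adj := fun u v =>
  match u, v with
  | none, none => isFalse (SimpleGraph.irrefl _)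
  | none, some v => decidable_of_iff _ (triangleY_none_some G a b c v).symm
  | some u, none => decidable_of_iff _ (triangleY_some_none G a b c u).symm
  | some u, some v => decidable_of_iff _ (triangleY_some_some G a b c u v).symm

/-- The graph `K_{3,3,1}`. -/
def K331 : SimpleGraph (Fin 7) where
  Adj i j := i.1 / 3 ≠ j.1 / 3
  symm := ⟨fun _ _ h => h.symm⟩
  loopless := ⟨fun _ h => h rfl⟩

instance : DecidableRel K331.Adj := fun i j => inferInstanceAs (Decidable (i.1 / 3 ≠ j.1 / 3))

/-- The graph obtained from `K₆` by one `∇Y`-move. -/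
abbrev P7 : SimpleGraph (Option (Fin 6)) := triangleY (⊤ : SimpleGraph (Fin 6)) 0 1 2

theorem P7_family : IsPetersenFamily P7 :=
  IsPetersenFamily.deltaY IsPetersenFamily.k6 (by decide) (by decide) (by decide)

/-- The vertex map of an isomorphism. -/
def isoMap : Option (Option (Fin 6)) → Option (Fin 7)
  | none => some 2
  | some none => some 5
  | some (some i) => (![none, some 0, some 1, some 3, some 4, some 6] : Fin 6 → Option (Fin 7)) i

theorem K331_family : IsPetersenFamily K331 := by
  have h8 : IsPetersenFamily (triangleY P7 (some 0) (some 3) (some 4)) :=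
    IsPetersenFamily.deltaY P7_family (by decide) (by decide) (by decide)
  have hb : Function.Bijective isoMap := by
    rw [Fintype.bijective_iff_injective_and_card]
    exact ⟨by decide, by decide⟩
  have hadj : ∀ u v, (triangleY K331 5 2 6).Adj (isoMap u) (isoMap v) ↔
      (triangleY P7 (some 0) (some 3) (some 4)).Adj u v := by
    decide
  have iso : triangleY P7 (some 0) (some 3) (some 4) ≃g triangleY K331 5 2 6 :=
    ⟨Equiv.ofBijective isoMap hb, fun {u v} => hadj u v⟩
  exact IsPetersenFamily.yDelta (IsPetersenFamily.iso h8 iso) (by decide) (by decide) (by decide)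

/-! ### `Y∇`-moves at an arbitrary vertex of degree three -/

/-- Result of the `Y∇`-move at `v` with neighbours `a, b, c`. -/
def yGraph {W : Type} (P : SimpleGraph W) (v a b c : W) : SimpleGraph {u // u ≠ v} where
  Adj p q := P.Adj p.1 q.1 ∨
    (p ≠ q ∧ (p.1 = a ∨ p.1 = b ∨ p.1 = c) ∧ (q.1 = a ∨ q.1 = b ∨ q.1 = c))
  symm := ⟨fun p q h => h.elim (fun h => Or.inl h.symm) (fun h => Or.inr ⟨h.1.symm, h.2.2, h.2.1⟩)⟩
  loopless := ⟨fun p h => h.elim (fun h => P.irrefl h) (fun h => h.1 rfl)⟩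

theorem yGraph_family {W : Type} {P : SimpleGraph W} (hP : IsPetersenFamily P) {v a b c : W}
    (hab : a ≠ b) (hac : a ≠ c) (hbc : b ≠ c)
    (nab : ¬ P.Adj a b) (nac : ¬ P.Adj a c) (nbc : ¬ P.Adj b c)
    (hN : ∀ u, P.Adj v u ↔ (u = a ∨ u = b ∨ u = c)) : IsPetersenFamily (yGraph P v a b c) := by
  classical
  have ha : a ≠ v := ((hN a).2 (by simp)).ne'
  have hb : b ≠ v := ((hN b).2 (by simp)).ne'
  have hc : c ≠ v := ((hN c).2 (by simp)).ne'
  have key : ∀ p q : Option {u // u ≠ v},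
      P.Adj (Equiv.optionSubtypeNe v p) (Equiv.optionSubtypeNe v q) ↔
      (triangleY (yGraph P v a b c) ⟨a, ha⟩ ⟨b, hb⟩ ⟨c, hc⟩).Adj p q := by
    intro p q
    rcases p with _ | p <;> rcases q with _ | q
    · simp
    · rw [triangleY_none_some]
      simp only [Equiv.optionSubtypeNe_none, Equiv.optionSubtypeNe_some, hN, Subtype.ext_iff]
    · rw [triangleY_some_none, SimpleGraph.adj_comm]
      simp only [Equiv.optionSubtypeNe_none, Equiv.optionSubtypeNe_some, hN, Subtype.ext_iff]
    · rw [triangleY_some_some]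
      simp only [Equiv.optionSubtypeNe_some, yGraph, Subtype.ext_iff, ne_eq]
      have nba : ¬ P.Adj b a := fun h => nab h.symm
      have nca : ¬ P.Adj c a := fun h => nac h.symm
      have ncb : ¬ P.Adj c b := fun h => nbc h.symm
      have na := P.irrefl (v := a)
      have nb := P.irrefl (v := b)
      have nc := P.irrefl (v := c)
      constructor
      · intro h
        refine ⟨Or.inl h, ?_⟩
        rintro ⟨h1 | h1 | h1, h2 | h2 | h2⟩ <;> rw [h1, h2] at h <;> contradiction
      · rintro ⟨h | h, h'⟩
        · exact h
        · exact absurd h.2 h'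
  have iso : triangleY (yGraph P v a b c) ⟨a, ha⟩ ⟨b, hb⟩ ⟨c, hc⟩ ≃g P :=
    ⟨Equiv.optionSubtypeNe v, fun {p q} => key p q⟩
  refine IsPetersenFamily.yDelta (IsPetersenFamily.iso hP iso.symm) ?_ ?_ ?_
  · exact Or.inr ⟨by simpa using hab, by simp, by simp⟩
  · exact Or.inr ⟨by simpa using hbc, by simp, by simp⟩
  · exact Or.inr ⟨by simpa using hac, by simp, by simp⟩

theorem top_family {T : Type} [Fintype T] (h : Fintype.card T = 6) :
    IsPetersenFamily (⊤ : SimpleGraph T) :=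
  IsPetersenFamily.iso IsPetersenFamily.k6
    (SimpleGraph.Iso.completeGraph (Fintype.equivFinOfCardEq h).symm)

/-! ### Clique sums -/

/-- The subgraph of `G` induced by `V₁ ∪ V₂` is the clique sum of those induced by `V₁`, `V₂`. -/
structure CliqueSum {V : Type} (G : SimpleGraph V) (V₁ V₂ : Set V) : Prop where
  edge : ∀ a b, a ∈ V₁ ∪ V₂ → b ∈ V₁ ∪ V₂ → G.Adj a b → (a ∈ V₁ ∧ b ∈ V₁) ∨ (a ∈ V₂ ∧ b ∈ V₂)
  clique : ∀ a b, a ∈ V₁ ∩ V₂ → b ∈ V₁ ∩ V₂ → a ≠ b → G.Adj a b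

theorem CliqueSum.symm {V : Type} {G : SimpleGraph V} {V₁ V₂ : Set V} (h : CliqueSum G V₁ V₂) :
    CliqueSum G V₂ V₁ :=
  ⟨fun a b ha hb hab => (h.edge a b (Or.symm ha) (Or.symm hb) hab).symm,
    fun a b ha hb hab => h.clique a b ⟨ha.2, ha.1⟩ ⟨hb.2, hb.1⟩ hab⟩

theorem CliqueSum.conn_inter {V : Type} {G : SimpleGraph V} {V₁ V₂ X : Set V}
    (h : CliqueSum G V₁ V₂) (hX : Conn G X) (hU : X ⊆ V₁ ∪ V₂) (hm : ∃ s ∈ X, s ∈ V₁ ∩ V₂) :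
    Conn G (X ∩ V₁) := by
  obtain ⟨s, hsX, hs⟩ := hm
  refine ⟨⟨s, hsX, hs.1⟩, ?_⟩
  rintro Y ⟨u, ⟨huX, hu1⟩, huY⟩ hc
  by_cases hYS : ∃ t ∈ X, t ∈ V₁ ∩ V₂ ∧ t ∈ Y
  · obtain ⟨t, htX, ht, htY⟩ := hYS
    have hall : ∀ t' ∈ X, t' ∈ V₁ ∩ V₂ → t' ∈ Y := by
      intro t' ht'X ht'
      by_cases hne : t = t'
      · rwa [← hne]
      · exact hc t ⟨htX, ht.1⟩ htY t' ⟨ht'X, ht'.1⟩ (h.clique t t' ht ht' hne)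
    have := hX.2 ((Y ∩ V₁) ∪ (V₂ \ V₁)) ⟨t, htX, Or.inl ⟨htY, ht.1⟩⟩ (by
      intro p hp hpY q hq hpq
      by_cases hq1 : q ∈ V₁
      · left
        refine ⟨?_, hq1⟩
        rcases hpY with hpY | hpY
        · exact hc p ⟨hp, hpY.2⟩ hpY.1 q ⟨hq, hq1⟩ hpq
        · rcases h.edge p q (hU hp) (hU hq) hpq with h' | h'
          · exact absurd h'.1 hpY.2
          · exact hall q hq ⟨hq1, h'.2⟩
      · right
        exact ⟨(hU hq).resolve_left hq1, hq1⟩)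
    rintro v ⟨hvX, hv1⟩
    rcases this hvX with hv | hv
    · exact hv.1
    · exact absurd hv1 hv.2
  · exfalso
    have := hX.2 (Y ∩ V₁) ⟨u, huX, huY, hu1⟩ (by
      intro p hp hpY q hq hpq
      have hp2 : p ∉ V₂ := fun hp2 => hYS ⟨p, hp, ⟨hpY.2, hp2⟩, hpY.1⟩
      have hq1 : q ∈ V₁ := by
        rcases h.edge p q (hU hp) (hU hq) hpq with h' | h'
        · exact h'.2
        · exact absurd h'.1 hp2
      exact ⟨hc p ⟨hp, hpY.2⟩ hpY.1 q ⟨hq, hq1⟩ hpq, hq1⟩)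
    exact hYS ⟨s, hsX, hs, (this hsX).1⟩

/-- A connected set avoiding the clique lies on one side. -/
theorem CliqueSum.side {V : Type} {G : SimpleGraph V} {V₁ V₂ X : Set V}
    (h : CliqueSum G V₁ V₂) (hX : Conn G X) (hU : X ⊆ V₁ ∪ V₂) (hm : ∀ s ∈ X, s ∉ V₁ ∩ V₂)
    {u : V} (hu : u ∈ X) (hu1 : u ∈ V₁) : X ⊆ V₁ := by
  apply hX.2 V₁ ⟨u, hu, hu1⟩
  intro p hp hp1 q hq hpq
  rcases h.edge p q (hU hp) (hU hq) hpq with h' | h'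
  · exact h'.2
  · exact absurd ⟨hp1, h'.1⟩ (hm p hp)

theorem CliqueSum.restrict {V W : Type} {G : SimpleGraph V} {V₁ V₂ : Set V} {P : SimpleGraph W}
    (h : CliqueSum G V₁ V₂) (f : W → Set V) (f1 : ∀ w, f w ⊆ V₁ ∪ V₂) (f2 : ∀ w, Conn G (f w))
    (f3 : ∀ w w', w ≠ w' → ∀ v, v ∈ f w → v ∉ f w')
    (f4 : ∀ w w', P.Adj w w' → ∃ v ∈ f w, ∃ v' ∈ f w', G.Adj v v')
    (f5 : ∀ w, (∃ s ∈ f w, s ∈ V₁ ∩ V₂) ∨ f w ⊆ V₁) : MinorOn P G V₁ := by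
  refine ⟨fun w => f w ∩ V₁, fun w => Set.inter_subset_right, fun w => ?_, ?_, ?_⟩
  · rcases f5 w with h5 | h5
    · exact h.conn_inter (f2 w) (f1 w) h5
    · change Conn G (f w ∩ V₁)
      rw [Set.inter_eq_left.2 h5]
      exact f2 w
  · intro w w' hw v hv hv'
    exact f3 w w' hw v hv.1 hv'.1
  · have aux : ∀ w w', ∀ v ∈ f w, ∀ v' ∈ f w', G.Adj v v' → (¬ ∃ s ∈ f w, s ∈ V₁ ∩ V₂) →
        v ∈ V₁ ∧ v' ∈ V₁ := by
      intro w w' v hv v' hv' hvv hno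
      have hsub := (f5 w).resolve_left hno
      rcases h.edge v v' (f1 w hv) (f1 w' hv') hvv with h' | h'
      · exact h'
      · exact absurd ⟨v, hv, hsub hv, h'.1⟩ hno
    intro w w' hww
    obtain ⟨v, hv, v', hv', hvv⟩ := f4 w w' hww
    by_cases h1 : ∃ s ∈ f w, s ∈ V₁ ∩ V₂
    · by_cases h2 : ∃ s ∈ f w', s ∈ V₁ ∩ V₂
      · obtain ⟨s, hs, hs'⟩ := h1
        obtain ⟨t, ht, ht'⟩ := h2
        refine ⟨s, ⟨hs, hs'.1⟩, t, ⟨ht, ht'.1⟩, h.clique s t hs' ht' ?_⟩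
        rintro rfl
        exact f3 w w' hww.ne s hs ht
      · have := aux w' w v' hv' v hv hvv.symm h2
        exact ⟨v, ⟨hv, this.2⟩, v', ⟨hv', this.1⟩, hvv⟩
    · have := aux w w' v hv v' hv' hvv h1
      exact ⟨v, ⟨hv, this.1⟩, v', ⟨hv', this.2⟩, hvv⟩

/-- A `∇Y`-type configuration gives a `P7` minor. -/
theorem CliqueSum.lemP7 {V ι : Type} [Fintype ι] [DecidableEq ι] (hι : Fintype.card ι = 4)
    {G : SimpleGraph V} {V₁ V₂ : Set V} (h : CliqueSum G V₁ V₂)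
    (s : ι → V) (F : ι → Set V) (X : Bool → Set V) (D : Set V) (i : ι)
    (hs : ∀ j, s j ∈ V₁ ∩ V₂) (hsF : ∀ j, s j ∈ F j)
    (hFU : ∀ j, F j ⊆ V₁ ∪ V₂) (hF : ∀ j, Conn G (F j))
    (hFF : ∀ j k, j ≠ k → ∀ v, v ∈ F j → v ∉ F k)
    (hX1 : ∀ b, X b ⊆ V₁) (hX : ∀ b, Conn G (X b)) (hXF : ∀ b j v, v ∈ X b → v ∉ F j)
    (hXX : ∀ v, v ∈ X true → v ∉ X false)
    (hXFe : ∀ b j, ∃ u ∈ X b, ∃ v ∈ F j, G.Adj u v)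
    (hD : Conn G D) (hDF : D ⊆ F i) (hsD : s i ∉ D) (hD1 : D ⊆ V₁)
    (hDX : ∀ b, ∃ u ∈ X b, ∃ v ∈ D, G.Adj u v) (hDs : ∃ v ∈ D, G.Adj (s i) v) :
    ¬ LinkOn G V₁ := by
  intro hlink
  let T := Option Bool ⊕ {j // j ≠ i}
  have hT : Fintype.card T = 6 := by
    simp [T, hι]
  have hfam := IsPetersenFamily.deltaY (a := (Sum.inl none : T)) (b := Sum.inl (some true))
    (c := Sum.inl (some false)) (top_family hT) (by simp) (by simp) (by simp)
  refine hlink _ hfam ?_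
  let f : Option T → Set V := fun
    | none => D
    | some (Sum.inl none) => {s i}
    | some (Sum.inl (some b)) => X b
    | some (Sum.inr j) => F j.1
  have hss : ∀ j k, j ≠ k → G.Adj (s j) (s k) := by
    intro j k hjk
    refine h.clique _ _ (hs j) (hs k) ?_
    intro he
    exact hFF j k hjk (s j) (hsF j) (he ▸ hsF k)
  apply h.restrict f
  · rintro (_ | (_ | b) | j)
    · exact fun v hv => Or.inl (hD1 hv)
    · rintro v rfl
      exact Or.inl (hs i).1
    · exact fun v hv => Or.inl (hX1 b hv)
    · exact hFU j
  · rintro (_ | (_ | b) | j)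
    · exact hD
    · exact conn_singleton _ _
    · exact hX b
    · exact hF j
  · have hXX' : ∀ b b', b ≠ b' → ∀ v, v ∈ X b → v ∉ X b' := by
      intro b b' hb v hv hv'
      cases b <;> cases b' <;> simp at hb
      · exact hXX v hv' hv
      · exact hXX v hv hv'
    rintro (_ | (_ | b) | j) (_ | (_ | b') | k) hne v hv hv'
    · exact hne rfl
    · obtain rfl : v = s i := hv'
      exact hsD hv
    · exact hXF b' i v hv' (hDF hv)
    · exact hFF i k k.2.symm v (hDF hv) hv'
    · obtain rfl : v = s i := hv
      exact hsD hv'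
    · exact hne rfl
    · obtain rfl : v = s i := hv
      exact hXF b' i _ hv' (hsF i)
    · obtain rfl : v = s i := hv
      exact hFF i k k.2.symm _ (hsF i) hv'
    · exact hXF b i v hv (hDF hv')
    · obtain rfl : v = s i := hv'
      exact hXF b i _ hv (hsF i)
    · exact hXX' b b' (fun hb => hne (by rw [hb])) v hv hv'
    · exact hXF b k v hv hv'
    · exact hFF i j j.2.symm v (hDF hv') hv
    · obtain rfl : v = s i := hv'
      exact hFF i j j.2.symm _ (hsF i) hv
    · exact hXF b' j v hv' hv
    · exact hFF j k (fun hjk => hne (by rw [Subtype.ext hjk])) v hv hv'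
  · have aux : ∀ {A B : Set V}, (∃ u ∈ A, ∃ v ∈ B, G.Adj u v) → ∃ u ∈ B, ∃ v ∈ A, G.Adj u v := by
      rintro A B ⟨u, hu, v, hv, huv⟩
      exact ⟨v, hv, u, hu, huv.symm⟩
    have hsD' : ∃ u ∈ ({s i} : Set V), ∃ v ∈ D, G.Adj u v := by
      obtain ⟨v, hv, h'⟩ := hDs
      exact ⟨_, rfl, v, hv, h'⟩
    have hsF' : ∀ j : {j // j ≠ i}, ∃ u ∈ ({s i} : Set V), ∃ v ∈ F j.1, G.Adj u v := fun j =>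
      ⟨s i, rfl, s j, hsF j, hss i j j.2.symm⟩
    rintro (_ | (_ | b) | j) (_ | (_ | b') | k) hadj
    · exact absurd hadj (SimpleGraph.irrefl _)
    · exact aux hsD'
    · exact aux (hDX b')
    · rw [triangleY_none_some] at hadj
      simp at hadj
    · exact hsD'
    · exact absurd hadj (SimpleGraph.irrefl _)
    · rw [triangleY_some_some] at hadj
      cases b' <;> simp at hadj
    · exact hsF' k
    · exact hDX b
    · rw [triangleY_some_some] at hadj
      cases b <;> simp at hadj
    · rw [triangleY_some_some] at hadj
      cases b <;> cases b' <;> simp at hadj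
    · exact hXFe b k
    · rw [triangleY_some_none] at hadj
      simp at hadj
    · exact aux (hsF' j)
    · exact aux (hXFe b' j)
    · rw [triangleY_some_some] at hadj
      refine ⟨s j, hsF j, s k, hsF k, hss j k ?_⟩
      intro hjk
      exact hadj.1.ne (by rw [Subtype.ext hjk])
  · rintro (_ | (_ | b) | j)
    · exact Or.inr hD1
    · exact Or.inl ⟨s i, rfl, hs i⟩
    · exact Or.inr (hX1 b)
    · exact Or.inl ⟨s j, hsF j, hs j⟩

/-- A connected set minus a point: a component next to a given outside set also meets the point. -/
theorem exists_branch {V : Type} {G : SimpleGraph V} {F X : Set V} {s : V} (hF : Conn G F)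
    (hs : s ∈ F) (hXF : ∃ u ∈ X, ∃ v ∈ F, G.Adj u v) :
    ∃ D : Set V, D ⊆ F \ {s} ∧ (D.Nonempty → IsComp G (F \ {s}) D ∧
      (∃ u ∈ X, ∃ v ∈ D, G.Adj u v) ∧ ∃ v ∈ D, G.Adj s v) ∧
      ((∃ u ∈ X, G.Adj s u) ∨ ∃ v ∈ D, G.Adj s v) := by
  obtain ⟨u, hu, v, hv, huv⟩ := hXF
  by_cases hvs : v = s
  · subst hvs
    exact ⟨∅, by simp, by simp, Or.inl ⟨u, hu, huv.symm⟩⟩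
  · obtain ⟨D, hD, hvD⟩ := exists_comp G (F \ {s}) v ⟨hv, hvs⟩
    have hsD : ∃ w ∈ D, G.Adj s w := by
      by_contra hno
      have := hF.2 D ⟨v, hv, hvD⟩ (by
        intro p hp hpD q hq hpq
        by_cases hqs : q = s
        · subst hqs
          exact absurd ⟨p, hpD, hpq.symm⟩ hno
        · exact hD.2.2 p hpD q ⟨hq, hqs⟩ hpq)
      exact (hD.2.1 (this hs)).2 rfl
    exact ⟨D, hD.2.1, fun _ => ⟨hD, ⟨u, hu, v, hvD, huv⟩, hsD⟩, Or.inr hsD⟩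

theorem CliqueSum.lemX {V ι : Type} [Fintype ι] [DecidableEq ι] (hι : Fintype.card ι = 4)
    {G : SimpleGraph V} {V₁ V₂ : Set V} (h : CliqueSum G V₁ V₂)
    (s : ι → V) (F : ι → Set V) (X : Bool → Set V) (C : Set V)
    (hs : ∀ j, s j ∈ V₁ ∩ V₂) (hsF : ∀ j, s j ∈ F j)
    (hFU : ∀ j, F j ⊆ V₁ ∪ V₂) (hF : ∀ j, Conn G (F j))
    (hFF : ∀ j k, j ≠ k → ∀ v, v ∈ F j → v ∉ F k)
    (hFS : ∀ j v, v ∈ F j → v ∈ V₁ ∩ V₂ → v = s j)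
    (hC : IsComp G ((V₁ ∪ V₂) \ (V₁ ∩ V₂)) C) (hC1 : C ⊆ V₁)
    (hXC : ∀ b, X b ⊆ C) (hX : ∀ b, Conn G (X b)) (hXF : ∀ b j v, v ∈ X b → v ∉ F j)
    (hXX : ∀ v, v ∈ X true → v ∉ X false)
    (hXFe : ∀ b j, ∃ u ∈ X b, ∃ v ∈ F j, G.Adj u v) :
    ¬ LinkOn G V₁ := by
  choose D hD1 hD2 hD3 using fun b j => exists_branch (hF j) (hsF j) (hXFe b j)
  have hDU : ∀ b j, D b j ⊆ (V₁ ∪ V₂) \ (V₁ ∩ V₂) := by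
    intro b j v hv
    exact ⟨hFU j (hD1 b j hv).1, fun hvS => (hD1 b j hv).2 (hFS j v (hD1 b j hv).1 hvS)⟩
  have hDC : ∀ b j, D b j ⊆ C := by
    intro b j v hv
    obtain ⟨h1, ⟨p, hp, q, hq, hpq⟩, _⟩ := hD2 b j ⟨v, hv⟩
    exact hC.subset h1.1 (hDU b j) ⟨q, hq, hC.2.2 p (hXC b hp) q (hDU b j hq) hpq⟩ hv
  by_cases hmeet : ∃ j, ∃ v, v ∈ D true j ∧ v ∈ D false j
  · obtain ⟨j, v, hv, hv'⟩ := hmeet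
    obtain ⟨a1, a2, a3⟩ := hD2 true j ⟨v, hv⟩
    obtain ⟨b1, b2, b3⟩ := hD2 false j ⟨v, hv'⟩
    have he := a1.eq b1 ⟨v, hv, hv'⟩
    refine h.lemP7 hι s F X (D true j) j hs hsF hFU hF hFF (fun b => (hXC b).trans hC1) hX hXF hXX
      hXFe a1.1 (fun v hv => (hD1 true j hv).1) (fun hv => (hD1 true j hv).2 rfl)
      ((hDC true j).trans hC1) ?_ a3
    intro b
    cases b
    · rw [he]; exact b2
    · exact a2
  · intro hlink
    let Z : Bool → Set V := fun b => X b ∪ ⋃ j, D b j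
    have hZ : ∀ b, Conn G (Z b) := fun b => conn_union_iUnion (hX b) (D b)
      (fun j hj => ⟨(hD2 b j hj).1.1, (hD2 b j hj).2.1⟩)
    have hZC : ∀ b, Z b ⊆ C := by
      rintro b v (hv | hv)
      · exact hXC b hv
      · obtain ⟨j, hj⟩ := Set.mem_iUnion.1 hv
        exact hDC b j hj
    have hZs : ∀ b j, ∃ v ∈ Z b, G.Adj (s j) v := by
      intro b j
      rcases hD3 b j with ⟨u, hu, h'⟩ | ⟨u, hu, h'⟩
      · exact ⟨u, Or.inl hu, h'⟩
      · exact ⟨u, Or.inr (Set.mem_iUnion.2 ⟨j, hu⟩), h'⟩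
    have hZZ : ∀ v, v ∈ Z true → v ∉ Z false := by
      rintro v (hv | hv) (hv' | hv')
      · exact hXX v hv hv'
      · obtain ⟨j, hj⟩ := Set.mem_iUnion.1 hv'
        exact hXF true j v hv (hD1 false j hj).1
      · obtain ⟨j, hj⟩ := Set.mem_iUnion.1 hv
        exact hXF false j v hv' (hD1 true j hj).1
      · obtain ⟨j, hj⟩ := Set.mem_iUnion.1 hv
        obtain ⟨k, hk⟩ := Set.mem_iUnion.1 hv'
        by_cases hjk : j = k
        · subst hjk
          exact hmeet ⟨j, v, hj, hk⟩
        · exact hFF j k hjk v (hD1 true j hj).1 (hD1 false k hk).1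
    have hZ' : Z true ⊆ C \ Z false := fun v hv => ⟨hZC true hv, hZZ v hv⟩
    obtain ⟨z, hz⟩ := (hZ true).1
    obtain ⟨E, hE, hzE⟩ := exists_comp G (C \ Z false) z (hZ' hz)
    have hZE : Z true ⊆ E := hE.subset (hZ true) hZ' ⟨z, hz, hzE⟩
    have hEZ : ∃ u ∈ E, ∃ v ∈ Z false, G.Adj u v := by
      by_contra hno
      have := hC.1.2 E ⟨z, hZC true hz, hzE⟩ (by
        intro p hp hpE q hq hpq
        by_cases hqZ : q ∈ Z false
        · exact absurd ⟨p, hpE, q, hqZ, hpq⟩ hno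
        · exact hE.2.2 p hpE q ⟨hq, hqZ⟩ hpq)
      obtain ⟨y, hy⟩ := (hZ false).1
      exact (hE.2.1 (this (hZC false hy))).2 hy
    have hT : Fintype.card (ι ⊕ Bool) = 6 := by simp [hι]
    refine hlink _ (top_family hT) ?_
    let K : Bool → Set V := fun b => if b then E else Z false
    have hK1 : ∀ b, K b ⊆ C := by
      intro b
      cases b
      · exact hZC false
      · exact fun v hv => (hE.2.1 hv).1
    have hKs : ∀ b j, ∃ v ∈ K b, G.Adj (s j) v := by
      intro b j
      cases b
      · exact hZs false j
      · obtain ⟨v, hv, h'⟩ := hZs true j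
        exact ⟨v, hZE hv, h'⟩
    have hsC : ∀ j, s j ∉ C := fun j hj => (hC.2.1 hj).2 (hs j)
    refine ⟨fun | Sum.inl j => {s j} | Sum.inr b => K b, ?_, ?_, ?_, ?_⟩
    · rintro (j | b)
      · rintro v rfl
        exact (hs j).1
      · exact (hK1 b).trans hC1
    · rintro (j | b)
      · exact conn_singleton _ _
      · cases b
        · exact hZ false
        · exact hE.1
    · rintro (j | b) (k | b') hne v hv hv'
      · obtain rfl : v = s j := hv
        have hk : s j = s k := hv'
        exact hFF j k (fun hjk => hne (by rw [hjk])) (s j) (hsF j) (hk ▸ hsF k)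
      · obtain rfl : v = s j := hv
        exact hsC j (hK1 b' hv')
      · obtain rfl : v = s k := hv'
        exact hsC k (hK1 b hv)
      · cases b <;> cases b'
        · exact hne rfl
        · exact (hE.2.1 hv').2 hv
        · exact (hE.2.1 hv).2 hv'
        · exact hne rfl
    · rintro (j | b) (k | b') hadj
      · refine ⟨s j, rfl, s k, rfl, h.clique _ _ (hs j) (hs k) ?_⟩
        intro hk
        exact hFF j k (fun hjk => hadj.ne (by rw [hjk])) (s j) (hsF j) (hk ▸ hsF k)
      · obtain ⟨v, hv, h'⟩ := hKs b' j
        exact ⟨s j, rfl, v, hv, h'⟩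
      · obtain ⟨v, hv, h'⟩ := hKs b k
        exact ⟨v, hv, s k, rfl, h'.symm⟩
      · obtain ⟨u, hu, v, hv, h'⟩ := hEZ
        cases b <;> cases b'
        · exact absurd hadj (SimpleGraph.irrefl _)
        · exact ⟨v, hv, u, hu, h'.symm⟩
        · exact ⟨u, hu, v, hv, h'⟩
        · exact absurd hadj (SimpleGraph.irrefl _)

theorem finite_of_family {W : Type} {P : SimpleGraph W} (hP : IsPetersenFamily P) : Finite W := by
  obtain ⟨r, _, e, _⟩ := rep_of_family hP
  exact Finite.of_equiv _ e.symm

theorem card_of_family {W : Type} {P : SimpleGraph W} (hP : IsPetersenFamily P) :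
    6 ≤ Nat.card W := by
  obtain ⟨r, hr, e, _⟩ := rep_of_family hP
  rw [Nat.card_congr e, Nat.card_fin]
  have : ∀ r ∈ fam, 6 ≤ r.length := by decide
  exact this r hr

/-- The key induction step: a triple of connected sets attached to a four-clique. -/
theorem CliqueSum.step {V W : Type} {G : SimpleGraph V} {V₁ V₂ : Set V}
    (h : CliqueSum G V₁ V₂) (hfin : (V₁ ∩ V₂).Finite)
    (l1 : LinkOn G V₁) (l2 : LinkOn G V₂) (hS4 : (V₁ ∩ V₂).ncard = 4)
    (h3 : ∀ C : Fin 3 → Set V,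
      (∀ i, IsComp G ((V₁ ∪ V₂) \ (V₁ ∩ V₂)) (C i)) →
      (∀ i, ∀ s ∈ V₁ ∩ V₂, ∃ u ∈ C i, G.Adj s u) → ∃ i j, i ≠ j ∧ C i = C j)
    {A : Set W} (hA : Nat.card A = 4) [Finite A]
    (s : A → V) (F : A → Set V)
    (hs : ∀ j, s j ∈ V₁ ∩ V₂) (hsF : ∀ j, s j ∈ F j)
    (hFU : ∀ j, F j ⊆ V₁ ∪ V₂) (hF : ∀ j, Conn G (F j))
    (hFF : ∀ j k, j ≠ k → ∀ v, v ∈ F j → v ∉ F k)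
    (X : Fin 3 → Set V) (hX : ∀ b, Conn G (X b)) (hXU : ∀ b, X b ⊆ (V₁ ∪ V₂) \ (V₁ ∩ V₂))
    (hXF : ∀ b j v, v ∈ X b → v ∉ F j)
    (hXX : ∀ b c, b ≠ c → ∀ v, v ∈ X b → v ∉ X c)
    (hXFe : ∀ b j, ∃ u ∈ X b, ∃ v ∈ F j, G.Adj u v) : False := by
  classical
  have hinj : Function.Injective (fun j => (⟨s j, hs j⟩ : ↥(V₁ ∩ V₂))) := by
    intro j k hjk
    by_contra hne
    have hjk' : s j = s k := congrArg Subtype.val hjk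
    exact hFF j k hne (s j) (hsF j) (hjk' ▸ hsF k)
  have : Finite ↥(V₁ ∩ V₂) := hfin
  have hbij := hinj.bijective_of_nat_card_le (by rw [Nat.card_coe_set_eq, hS4, hA])
  have hsurj : ∀ v ∈ V₁ ∩ V₂, ∃ j, s j = v := by
    intro v hv
    obtain ⟨j, hj⟩ := hbij.2 ⟨v, hv⟩
    exact ⟨j, congrArg Subtype.val hj⟩
  have hFS : ∀ j v, v ∈ F j → v ∈ V₁ ∩ V₂ → v = s j := by
    intro j v hv hvS
    obtain ⟨k, rfl⟩ := hsurj v hvS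
    by_contra hne
    exact hFF j k (fun hjk => hne (by rw [hjk])) _ hv (hsF k)
  choose C hC hXC using fun b => (hX b).1.elim
    (fun v hv => (exists_comp G _ v (hXU b hv)).imp fun C hC =>
      (⟨hC.1, hC.1.subset (hX b) (hXU b) ⟨v, hv, hC.2⟩⟩ : _ ∧ X b ⊆ C))
  have hatt : ∀ i, ∀ s ∈ V₁ ∩ V₂, ∃ u ∈ C i, G.Adj s u := by
    intro b v hv
    obtain ⟨j, rfl⟩ := hsurj v hv
    obtain ⟨D, hD1, hD2, hD3⟩ := exists_branch (hF j) (hsF j) (hXFe b j)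
    rcases hD3 with ⟨u, hu, h'⟩ | ⟨u, hu, h'⟩
    · exact ⟨u, hXC b hu, h'⟩
    · obtain ⟨h1, ⟨p, hp, q, hq, hpq⟩, _⟩ := hD2 ⟨u, hu⟩
      have hDU : D ⊆ (V₁ ∪ V₂) \ (V₁ ∩ V₂) := fun v hv =>
        ⟨hFU j (hD1 hv).1, fun hvS => (hD1 hv).2 (hFS j v (hD1 hv).1 hvS)⟩
      exact ⟨u, (hC b).subset h1.1 hDU
        ⟨q, hq, (hC b).2.2 p (hXC b hp) q (hDU hq) hpq⟩ hu, h'⟩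
  obtain ⟨i, j, hij, hCC⟩ := h3 C hC hatt
  have := Fintype.ofFinite A
  have hcard : Fintype.card A = 4 := by rw [← Nat.card_eq_fintype_card, hA]
  let Y : Bool → Set V := fun b => if b then X i else X j
  have hYC : ∀ b, Y b ⊆ C i := by
    intro b
    cases b
    · rw [hCC]; exact hXC j
    · exact hXC i
  have hY : ∀ b, ∃ k, Y b = X k := by
    intro b
    cases b
    · exact ⟨j, rfl⟩
    · exact ⟨i, rfl⟩
  have y1 : ∀ b, Conn G (Y b) := by
    intro b; obtain ⟨k, hk⟩ := hY b; rw [hk]; exact hX k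
  have y2 : ∀ b k v, v ∈ Y b → v ∉ F k := by
    intro b; obtain ⟨k, hk⟩ := hY b; rw [hk]; exact hXF k
  have y3 : ∀ b k, ∃ u ∈ Y b, ∃ v ∈ F k, G.Adj u v := by
    intro b; obtain ⟨k, hk⟩ := hY b; rw [hk]; exact hXFe k
  have y4 : ∀ v, v ∈ Y true → v ∉ Y false := hXX i j hij
  obtain ⟨c, hc⟩ := (hC i).1.1
  rcases ((hC i).2.1 hc).1 with hc1 | hc2
  · have hC1 := h.side (hC i).1 (fun v hv => ((hC i).2.1 hv).1) (fun v hv => ((hC i).2.1 hv).2) hc hc1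
    exact h.lemX hcard s F Y (C i) hs hsF hFU hF hFF hFS (hC i) hC1 hYC y1 y2 y4 y3 l1
  · have hU : V₂ ∪ V₁ = V₁ ∪ V₂ := Set.union_comm _ _
    have hI : V₂ ∩ V₁ = V₁ ∩ V₂ := Set.inter_comm _ _
    have hC1 := h.symm.side (hC i).1 (fun v hv => by rw [hU]; exact ((hC i).2.1 hv).1)
      (fun v hv => by rw [hI]; exact ((hC i).2.1 hv).2) hc hc2
    exact h.symm.lemX hcard s F Y (C i) (by rw [hI]; exact hs) hsF (by rw [hU]; exact hFU) hF hFF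
      (by rw [hI]; exact hFS) (by rw [hI, hU]; exact hC i) hC1 hYC y1 y2 y4 y3 l2

theorem CliqueSum.main {V : Type} {G : SimpleGraph V} {V₁ V₂ : Set V}
    (h : CliqueSum G V₁ V₂) (hfin : (V₁ ∩ V₂).Finite) (hS : (V₁ ∩ V₂).ncard ≤ 4)
    (l1 : LinkOn G V₁) (l2 : LinkOn G V₂)
    (h3 : (V₁ ∩ V₂).ncard = 4 → ∀ C : Fin 3 → Set V,
      (∀ i, IsComp G ((V₁ ∪ V₂) \ (V₁ ∩ V₂)) (C i)) →
      (∀ i, ∀ s ∈ V₁ ∩ V₂, ∃ u ∈ C i, G.Adj s u) → ∃ i j, i ≠ j ∧ C i = C j) :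
    LinkOn G (V₁ ∪ V₂) := by
  suffices H : ∀ n : ℕ, ∀ (W : Type) (P : SimpleGraph W), Nat.card W = n → IsPetersenFamily P →
      ¬ MinorOn P G (V₁ ∪ V₂) from fun W P hP => H _ W P rfl hP
  intro n
  induction n with
  | zero =>
    intro W P hn hP
    have := card_of_family hP
    omega
  | succ n ih =>
    intro W P hn hP hm
    have hfW := finite_of_family hP
    have hm0 := hm
    obtain ⟨f, f1, f2, f3, f4⟩ := hm
    let A : Set W := {w | ∃ s ∈ f w, s ∈ V₁ ∩ V₂}
    let L : Set W := {w | f w ⊆ V₁}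
    have hnA : ∀ w, w ∉ A → ∀ v ∈ f w, v ∉ V₁ ∩ V₂ := fun w hw v hv hvS => hw ⟨v, hv, hvS⟩
    have hside : ∀ w, w ∉ A → w ∉ L → f w ⊆ V₂ := by
      intro w hw hwL
      obtain ⟨v, hv, hv1⟩ := Set.not_subset.1 hwL
      exact h.symm.side (f2 w) (fun u hu => Or.symm (f1 w hu))
        (fun u hu hu' => hnA w hw u hu ⟨hu'.2, hu'.1⟩) hv ((f1 w hv).resolve_left hv1)
    by_cases hR : ∃ l, l ∉ L ∧ l ∉ A
    swap
    · refine l1 P hP (h.restrict f f1 f2 f3 f4 fun w => ?_)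
      by_cases hw : w ∈ A
      · exact Or.inl hw
      · exact Or.inr (by_contra fun hwL => hR ⟨w, hwL, hw⟩)
    by_cases hL : ∃ l, l ∈ L ∧ l ∉ A
    swap
    · refine l2 P hP (h.symm.restrict f (fun w v hv => Or.symm (f1 w hv)) f2 f3 f4 fun w => ?_)
      by_cases hw : w ∈ A
      · obtain ⟨s, hs, hs'⟩ := hw
        exact Or.inl ⟨s, hs, hs'.2, hs'.1⟩
      · exact Or.inr (hside w hw fun hwL => hL ⟨w, hwL, hw⟩)
    choose s hsF hs using fun a : A => a.2
    have hsinj : Function.Injective (fun j => (⟨s j, hs j⟩ : ↥(V₁ ∩ V₂))) := by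
      intro j k hjk
      by_contra hne
      have hjk' : s j = s k := congrArg Subtype.val hjk
      exact f3 j k (fun h => hne (Subtype.ext h)) (s j) (hsF j) (hjk' ▸ hsF k)
    have : Finite ↥(V₁ ∩ V₂) := hfin
    have hAS : A.ncard ≤ (V₁ ∩ V₂).ncard := by
      rw [← Nat.card_coe_set_eq, ← Nat.card_coe_set_eq]
      exact Nat.card_le_card_of_injective _ hsinj
    have hLR : ∀ u v, u ∉ A → v ∉ A → P.Adj u v → (u ∈ L ↔ v ∈ L) := by
      have aux : ∀ u v, u ∉ A → v ∉ A → P.Adj u v → u ∈ L → v ∈ L := by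
        intro u v hu hv huv huL
        by_contra hvL
        obtain ⟨p, hp, q, hq, hpq⟩ := f4 u v huv
        have hp1 := huL hp
        have hq2 := hside v hv hvL hq
        rcases h.edge p q (f1 u hp) (f1 v hq) hpq with h' | h'
        · exact hnA v hv q hq ⟨h'.2, hq2⟩
        · exact hnA u hu p hp ⟨hp1, h'.1⟩
      exact fun u v hu hv huv => ⟨aux u v hu hv huv, aux v u hv hu huv.symm⟩
    rcases cut_claim hP A L hL hR hLR (hAS.trans hS) with
      ⟨v, a, b, c, hv, ha, hb, hc, hab, hac, hbc, nab, nac, nbc, hN⟩ | ⟨hA4, K, hK, hKd⟩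
    · refine ih _ (yGraph P v a b c) ?_ (yGraph_family hP hab hac hbc nab nac nbc hN) ?_
      · have : Nat.card {u // u ≠ v} + 1 = Nat.card W := by
          classical
          rw [← Finite.card_option]
          exact Nat.card_congr (Equiv.optionSubtypeNe v)
        omega
      · refine ⟨fun u => f u.1, fun u => f1 u.1, fun u => f2 u.1,
          fun u u' hu => f3 u.1 u'.1 (fun h => hu (Subtype.ext h)), ?_⟩
        rintro p q (hpq | ⟨hne, hp, hq⟩)
        · exact f4 _ _ hpq
        · have hpA : p.1 ∈ A := by rcases hp with hp | hp | hp <;> rw [hp] <;> assumption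
          have hqA : q.1 ∈ A := by rcases hq with hq | hq | hq <;> rw [hq] <;> assumption
          obtain ⟨s, hs, hs'⟩ := hpA
          obtain ⟨t, ht, ht'⟩ := hqA
          refine ⟨s, hs, t, ht, h.clique s t hs' ht' ?_⟩
          rintro rfl
          exact f3 p.1 q.1 (fun h => hne (Subtype.ext h)) s hs ht
    · have hS4 : (V₁ ∩ V₂).ncard = 4 := by omega
      have hkA : ∀ (k : W), k ∉ A → ∀ j : A, k ≠ j.1 := fun k hk j hkj => hk (hkj ▸ j.2)
      refine h.step hfin l1 l2 hS4 (h3 hS4) (A := A) (by rw [Nat.card_coe_set_eq, hA4]) s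
        (fun a => f a.1) hs hsF (fun j => f1 _) (fun j => f2 _)
        (fun j k hjk => f3 _ _ (fun h => hjk (Subtype.ext h)))
        (fun i => f (K i).1 ∪ f (K i).2) ?_ ?_ ?_ ?_ ?_
      · intro i
        obtain ⟨k1, k2, k3 | k3, k4⟩ := hK i
        · rw [← k3, Set.union_self]
          exact f2 _
        · exact conn_union (f2 _) (f2 _) (f4 _ _ k3)
      · rintro i v (hv | hv)
        · exact ⟨f1 _ hv, hnA _ (hK i).1 v hv⟩
        · exact ⟨f1 _ hv, hnA _ (hK i).2.1 v hv⟩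
      · rintro i j v (hv | hv)
        · exact f3 _ _ (hkA _ (hK i).1 j) v hv
        · exact f3 _ _ (hkA _ (hK i).2.1 j) v hv
      · rintro i j hij v (hv | hv) (hv' | hv')
        · exact f3 _ _ (hKd i j hij).1 v hv hv'
        · exact f3 _ _ (hKd i j hij).2.1 v hv hv'
        · exact f3 _ _ (hKd i j hij).2.2.1 v hv hv'
        · exact f3 _ _ (hKd i j hij).2.2.2 v hv hv'
      · intro i j
        rcases (hK i).2.2.2 j.1 j.2 with h' | h'
        · obtain ⟨p, hp, q, hq, hpq⟩ := f4 _ _ h'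
          exact ⟨p, Or.inl hp, q, hq, hpq⟩
        · obtain ⟨p, hp, q, hq, hpq⟩ := f4 _ _ h'
          exact ⟨p, Or.inr hp, q, hq, hpq⟩

/-! ### Components and strong separation -/

theorem isComp_supp {V : Type} (K : SimpleGraph V) (c : K.ConnectedComponent) :
    IsComp K Set.univ c.supp := by
  refine ⟨(conn_iff K _).1 c.connected_toSimpleGraph, Set.subset_univ _, ?_⟩
  intro u hu v _ huv
  exact (c.mem_supp_congr_adj huv).1 hu

theorem exists_supp {V : Type} (K : SimpleGraph V) {C : Set V} (hC : IsComp K Set.univ C) :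
    ∃ c : K.ConnectedComponent, c.supp = C := by
  obtain ⟨u, hu⟩ := hC.1.1
  exact ⟨K.connectedComponentMk u, (isComp_supp K _).eq hC ⟨u, rfl, hu⟩⟩

theorem isComp_image {V : Type} {G : SimpleGraph V} {U : Set V} {X C : Set U} :
    IsComp (G.induce U) X C ↔ IsComp G (Subtype.val '' X) (Subtype.val '' C) := by
  unfold IsComp
  rw [conn_image_val, Set.image_subset_image_iff Subtype.val_injective]
  refine and_congr_right fun _ => and_congr_right fun _ => ⟨?_, ?_⟩
  · rintro h _ ⟨u, hu, rfl⟩ _ ⟨v, hv, rfl⟩ huv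
    exact ⟨v, h u hu v hv huv, rfl⟩
  · intro h u hu v hv huv
    obtain ⟨w, hw, hwv⟩ := h u ⟨u, hu, rfl⟩ v ⟨v, hv, rfl⟩ huv
    rwa [← Subtype.ext hwv]

/-- Strong separation phrased with subsets of the big graph. -/
def SS {V : Type} (G : SimpleGraph V) (U T : Set V) : Prop :=
  ∃ C₁ C₂ : Set V, IsComp G (U \ T) C₁ ∧ IsComp G (U \ T) C₂ ∧ C₁ ≠ C₂ ∧
    ∀ v ∈ T, (∃ u ∈ C₁, G.Adj v u) ∧ (∃ u ∈ C₂, G.Adj v u)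

theorem ss_of_stronglySeparating {V : Type} {G : SimpleGraph V} {U : Set V} {T : Set U} :
    StronglySeparating (G.induce U) T → SS G U (Subtype.val '' T) := by
  rintro ⟨c₁, c₂, hne, hv⟩
  have himg : U \ (Subtype.val '' T) = Subtype.val '' (Tᶜ : Set U) := by
    ext v; simp
  have hcomp : ∀ c : ((G.induce U).induce Tᶜ).ConnectedComponent,
      IsComp G (U \ (Subtype.val '' T)) (Subtype.val '' (Subtype.val '' c.supp)) := by
    intro c
    have := isComp_image.1 (isComp_supp _ c)
    rw [Set.image_univ, Subtype.range_coe] at this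
    rw [himg]
    exact isComp_image.1 this
  refine ⟨_, _, hcomp c₁, hcomp c₂, ?_, ?_⟩
  · intro he
    have h1 := Set.image_injective.2 Subtype.val_injective
      (Set.image_injective.2 Subtype.val_injective he)
    exact hne (SimpleGraph.ConnectedComponent.supp_injective h1)
  · rintro _ ⟨v, hvT, rfl⟩
    obtain ⟨⟨u, hu, hu'⟩, ⟨w, hw, hw'⟩⟩ := hv v hvT
    exact ⟨⟨_, ⟨_, ⟨u, hu, rfl⟩, rfl⟩, hu'⟩, ⟨_, ⟨_, ⟨w, hw, rfl⟩, rfl⟩, hw'⟩⟩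

theorem stronglySeparating_of_ss {V : Type} {G : SimpleGraph V} {U : Set V} {T : Set U} :
    SS G U (Subtype.val '' T) → StronglySeparating (G.induce U) T := by
  rintro ⟨C₁, C₂, h1, h2, hne, hv⟩
  have himg : U \ (Subtype.val '' T) = Subtype.val '' (Tᶜ : Set U) := by
    ext v; simp
  have hcomp : ∀ C, IsComp G (U \ (Subtype.val '' T)) C →
      ∃ c : ((G.induce U).induce Tᶜ).ConnectedComponent,
        C = Subtype.val '' (Subtype.val '' c.supp) := by
    intro C hC
    rw [himg] at hC
    obtain ⟨D, hD, rfl⟩ := Set.subset_image_iff.1 hC.2.1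
    have hC' := isComp_image.2 hC
    obtain ⟨E, rfl⟩ : ∃ E : Set ↥(Tᶜ : Set U), D = Subtype.val '' E :=
      ⟨Subtype.val ⁻¹' D, by rw [Subtype.image_preimage_coe, Set.inter_eq_right.2 hD]⟩
    obtain ⟨c, hc⟩ := exists_supp ((G.induce U).induce Tᶜ) (C := E) (isComp_image.2 (by
      rw [Set.image_univ, Subtype.range_coe]
      exact hC'))
    exact ⟨c, by rw [hc]⟩
  obtain ⟨c₁, rfl⟩ := hcomp C₁ h1
  obtain ⟨c₂, rfl⟩ := hcomp C₂ h2
  refine ⟨c₁, c₂, fun he => hne (by rw [he]), ?_⟩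
  intro v hvT
  obtain ⟨⟨_, ⟨_, ⟨u, hu, rfl⟩, rfl⟩, hu'⟩, ⟨_, ⟨_, ⟨w, hw, rfl⟩, rfl⟩, hw'⟩⟩ := hv v ⟨v, hvT, rfl⟩
  exact ⟨⟨u, hu, hu'⟩, ⟨w, hw, hw'⟩⟩

theorem attached_of_minimal {V : Type} {G : SimpleGraph V} {S : Set V}
    (h : IsMinimalVertexCut G S) {C : Set V} (hC : IsComp G Sᶜ C) {s : V} (hs : s ∈ S) :
    ∃ u ∈ C, G.Adj s u := by
  by_contra hno
  refine h.2 (S \ {s}) ⟨Set.sdiff_subset, fun hsub => (hsub hs).2 rfl⟩ ⟨h.1.1, fun hpre => ?_⟩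
  have hmem : s ∈ (S \ {s})ᶜ := fun hs' => hs'.2 rfl
  have hconn : Conn G (S \ {s})ᶜ := by
    rw [← conn_iff]
    have : Nonempty ↥(S \ {s})ᶜ := ⟨⟨s, hmem⟩⟩
    exact ⟨hpre⟩
  obtain ⟨c, hc⟩ := hC.1.1
  have := hconn.2 C ⟨c, fun hc' => hC.2.1 hc hc'.1, hc⟩ (by
    intro p _ hpC q hq hpq
    by_cases hqs : q = s
    · subst hqs
      exact absurd ⟨p, hpC, hpq.symm⟩ hno
    · exact hC.2.2 p hpC q (fun hqS => hq ⟨hqS, hqs⟩) hpq)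
  exact hC.2.1 (this hmem) hs

theorem conn_congr {V : Type} {G H : SimpleGraph V} {X : Set V} (h : Conn G X)
    (hGH : ∀ u ∈ X, ∀ v ∈ X, G.Adj u v → H.Adj u v) : Conn H X :=
  ⟨h.1, fun Y hY hc => h.2 Y hY fun u hu huY v hv huv => hc u hu huY v hv (hGH u hu v hv huv)⟩

theorem IsComp.transfer {V : Type} {G H : SimpleGraph V} {U U' C : Set V} (h : IsComp G U C)
    (hC : C ⊆ U') (hU : U' ⊆ U) (hGH : ∀ u ∈ U', ∀ v ∈ U', (G.Adj u v ↔ H.Adj u v)) :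
    IsComp H U' C :=
  ⟨conn_congr h.1 fun u hu v hv => (hGH u (hC hu) v (hC hv)).1, hC,
    fun u hu v hv huv => h.2.2 u hu v (hU hv) ((hGH u (hC hu) v hv).2 huv)⟩

/-! ### The backward direction -/

/-- Indexing of the vertices of `K₃,₃,₁`. -/
def k331Idx : Fin 7 → Fin 3 ⊕ Fin 3 ⊕ Unit :=
  ![Sum.inl 0, Sum.inl 1, Sum.inl 2, Sum.inr (Sum.inl 0), Sum.inr (Sum.inl 1),
    Sum.inr (Sum.inl 2), Sum.inr (Sum.inr ())]

theorem K331_minor {V : Type} {G : SimpleGraph V} (p : Fin 3 → V) (Q : Fin 3 → Set V) (a : V)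
    (hp : Function.Injective p) (hQ : ∀ i, Conn G (Q i))
    (hQQ : ∀ i j, i ≠ j → ∀ v, v ∈ Q i → v ∉ Q j) (hpQ : ∀ i j, p i ∉ Q j)
    (hpa : ∀ i, p i ≠ a) (haQ : ∀ j, a ∉ Q j)
    (e1 : ∀ i j, ∃ v ∈ Q j, G.Adj (p i) v) (e2 : ∀ i, G.Adj (p i) a)
    (e3 : ∀ j, ∃ v ∈ Q j, G.Adj a v) : MinorOn K331 G Set.univ := by
  have i1 : Function.Injective k331Idx := by decide
  have i2 : ∀ i j, K331.Adj i j → ¬ ∃ k l, k331Idx i = Sum.inl k ∧ k331Idx j = Sum.inl l := by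
    decide
  have i3 : ∀ i j, K331.Adj i j → ¬ ∃ k l, k331Idx i = Sum.inr (Sum.inl k) ∧
      k331Idx j = Sum.inr (Sum.inl l) := by decide
  have i4 : ∀ i j, K331.Adj i j → k331Idx i ≠ k331Idx j := fun i j h h' => h.ne (i1 h')
  let g : Fin 3 ⊕ Fin 3 ⊕ Unit → Set V := fun
    | Sum.inl i => {p i}
    | Sum.inr (Sum.inl j) => Q j
    | Sum.inr (Sum.inr _) => {a}
  refine ⟨fun i => g (k331Idx i), fun _ => Set.subset_univ _, ?_, ?_, ?_⟩
  · intro i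
    dsimp only
    rcases k331Idx i with k | k | k
    · exact conn_singleton _ _
    · exact hQ k
    · exact conn_singleton _ _
  · intro i j hij
    have hne : k331Idx i ≠ k331Idx j := fun h => hij (i1 h)
    dsimp only
    generalize k331Idx i = s at hne
    generalize k331Idx j = t at hne
    rcases s with k | k | k <;> rcases t with l | l | l <;> intro v hv hv'
    · have h1 : v = p k := hv
      have h2 : v = p l := hv'
      exact hne (by rw [hp (h1.symm.trans h2)])
    · obtain rfl : v = p k := hv
      exact hpQ k l hv'
    · obtain rfl : v = p k := hv
      exact hpa k hv'
    · obtain rfl : v = p l := hv'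
      exact hpQ l k hv
    · exact hQQ k l (fun h => hne (by rw [h])) v hv hv'
    · obtain rfl : v = a := hv'
      exact haQ k hv
    · obtain rfl : v = p l := hv'
      exact hpa l hv
    · obtain rfl : v = a := hv
      exact haQ l hv'
    · exact hne rfl
  · intro i j hij
    have h2 := i2 i j hij
    have h3 := i3 i j hij
    have h4 := i4 i j hij
    dsimp only
    generalize k331Idx i = s at h2 h3 h4
    generalize k331Idx j = t at h2 h3 h4
    rcases s with k | k | k <;> rcases t with l | l | l
    · exact absurd ⟨k, l, rfl, rfl⟩ h2
    · obtain ⟨v, hv, h'⟩ := e1 k l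
      exact ⟨_, rfl, v, hv, h'⟩
    · exact ⟨_, rfl, _, rfl, e2 k⟩
    · obtain ⟨v, hv, h'⟩ := e1 l k
      exact ⟨v, hv, _, rfl, h'.symm⟩
    · exact absurd ⟨k, l, rfl, rfl⟩ h3
    · obtain ⟨v, hv, h'⟩ := e3 k
      exact ⟨v, hv, _, rfl, h'.symm⟩
    · exact ⟨_, rfl, _, rfl, (e2 l).symm⟩
    · obtain ⟨v, hv, h'⟩ := e3 l
      exact ⟨_, rfl, v, hv, h'⟩
    · exact absurd rfl h4

theorem addEdge_le {V : Type} (G : SimpleGraph V) (a b : V) : G ≤ addEdge G a b := le_sup_left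

theorem not_linkless_of_side {V : Type} {G : SimpleGraph V} {U : Set V}
    (hU : IsMaxnil (G.induce U)) {a b : V} (ha : a ∈ U) (hb : b ∈ U) (hab : a ≠ b)
    (hn : ¬ G.Adj a b) : ¬ LinkOn (addEdge G a b) U := by
  have := hU.2 ⟨a, ha⟩ ⟨b, hb⟩ (fun h => hab (congrArg Subtype.val h)) hn
  rw [addEdge_induce, isLinkless_induce_iff] at this
  exact this

theorem CliqueSum.back {V : Type} {G : SimpleGraph V} {V₁ V₂ S : Set V} (h : CliqueSum G V₁ V₂)
    (hU : V₁ ∪ V₂ = Set.univ) (hI : V₁ ∩ V₂ = S) (p : Fin 3 → V) (hp : Function.Injective p)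
    (hS : S = Set.range p) (h₁ : IsMaxnil (G.induce V₁))
    (hatt : ∀ C, IsComp G Sᶜ C → ∀ s ∈ S, ∃ u ∈ C, G.Adj s u)
    (cond : ∀ t ∈ V₁, t ∉ S → (∀ s ∈ S, G.Adj s t) → SS G V₁ (insert t S))
    {a b : V} (ha : a ∈ V₁) (haS : a ∉ S) (hb : b ∈ V₂) (hbS : b ∉ S) :
    ¬ LinkOn (addEdge G a b) Set.univ := by
  intro hlink
  obtain ⟨B, hB, hbB⟩ := exists_comp G Sᶜ b hbS
  have hB2 : B ⊆ V₂ := h.symm.side hB.1 (fun v _ => by rw [Set.union_comm, hU]; trivial)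
    (fun s hs => by rw [Set.inter_comm, hI]; exact hB.2.1 hs) hbB hb
  have hBV1 : ∀ v ∈ B, v ∉ V₁ := fun v hv hv1 => hB.2.1 hv (hI ▸ ⟨hv1, hB2 hv⟩)
  have hab : a ≠ b := fun hab => hBV1 b hbB (hab ▸ ha)
  have hle := addEdge_le G a b
  have habadj : (addEdge G a b).Adj a b := (addEdge_adj _ _ _ _ _).2 (Or.inr ⟨hab, Or.inl ⟨rfl, rfl⟩⟩)
  have hS1 : S ⊆ V₁ := fun s hs => (hI.symm ▸ hs : s ∈ V₁ ∩ V₂).1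
  by_cases hall : ∀ s ∈ S, G.Adj s a
  · obtain ⟨C₁, C₂, c1, c2, hne, hc⟩ := cond a ha haS hall
    have hpS : ∀ i, p i ∈ S := fun i => hS ▸ Set.mem_range_self i
    have hc12 : ∀ v, v ∈ C₁ → v ∉ C₂ := fun v hv hv' => hne (c1.eq c2 ⟨v, hv, hv'⟩)
    have hBC : ∀ v, v ∈ B → v ∉ C₁ ∧ v ∉ C₂ := fun v hv =>
      ⟨fun hv' => hBV1 v hv (c1.2.1 hv').1, fun hv' => hBV1 v hv (c2.2.1 hv').1⟩
    refine hlink _ K331_family (K331_minor p ![B, C₁, C₂] a hp ?_ ?_ ?_ ?_ ?_ ?_ ?_ ?_)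
    · intro i
      fin_cases i
      · exact conn_mono hle hB.1
      · exact conn_mono hle c1.1
      · exact conn_mono hle c2.1
    · intro i j hij v hv hv'
      fin_cases i <;> fin_cases j
      · exact hij rfl
      · exact (hBC v hv).1 hv'
      · exact (hBC v hv).2 hv'
      · exact (hBC v hv').1 hv
      · exact hij rfl
      · exact hc12 v hv hv'
      · exact (hBC v hv').2 hv
      · exact hc12 v hv' hv
      · exact hij rfl
    · intro i j hv
      fin_cases j
      · exact hB.2.1 hv (hpS i)
      · exact (c1.2.1 hv).2 (Or.inr (hpS i))
      · exact (c2.2.1 hv).2 (Or.inr (hpS i))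
    · rintro i rfl
      exact haS (hpS i)
    · intro j hv
      fin_cases j
      · exact hBV1 a hv ha
      · exact (c1.2.1 hv).2 (Or.inl rfl)
      · exact (c2.2.1 hv).2 (Or.inl rfl)
    · intro i j
      have : ∃ v ∈ (![B, C₁, C₂] : Fin 3 → Set V) j, G.Adj (p i) v := by
        fin_cases j
        · exact hatt B hB _ (hpS i)
        · exact (hc _ (Or.inr (hpS i))).1
        · exact (hc _ (Or.inr (hpS i))).2
      obtain ⟨v, hv, h'⟩ := this
      exact ⟨v, hv, hle h'⟩
    · exact fun i => hle (hall _ (hpS i))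
    · intro j
      fin_cases j
      · exact ⟨b, hbB, habadj⟩
      · obtain ⟨v, hv, h'⟩ := (hc a (Or.inl rfl)).1
        exact ⟨v, hv, hle h'⟩
      · obtain ⟨v, hv, h'⟩ := (hc a (Or.inl rfl)).2
        exact ⟨v, hv, hle h'⟩
  · push Not at hall
    obtain ⟨s, hs, hsa⟩ := hall
    have has : a ≠ s := fun has => haS (has ▸ hs)
    refine not_linkless_of_side h₁ ha (hS1 hs) has (fun h => hsa h.symm) ?_
    intro W P hP hm
    classical
    refine hlink P hP (hm.trans (fun u => if u = s then {s} ∪ B else {u}) ?_ ?_ ?_ ?_)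
    · exact fun _ _ => Set.subset_univ _
    · intro u _
      split_ifs
      · obtain ⟨v, hv, h'⟩ := hatt B hB s hs
        exact conn_mono hle (conn_union (conn_singleton _ _) hB.1 ⟨s, rfl, v, hv, h'⟩)
      · exact conn_singleton _ _
    · intro u hu u' hu' hne v hv hv'
      split_ifs at hv hv' with q1 q2 q2
      · exact hne (q1.trans q2.symm)
      · obtain rfl : v = u' := hv'
        rcases hv with hv | hv
        · exact q2 hv
        · exact hBV1 _ hv hu'
      · obtain rfl : v = u := hv
        rcases hv' with hv' | hv'
        · exact q1 hv'
        · exact hBV1 _ hv' hu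
      · exact hne ((show v = u from hv).symm.trans hv')
    · have hself : ∀ u, u ∈ (if u = s then {s} ∪ B else {u} : Set V) := by
        intro u
        split_ifs with q
        · exact Or.inl q
        · rfl
      have hbs : b ∈ (if s = s then {s} ∪ B else {s} : Set V) := by
        rw [if_pos rfl]; exact Or.inr hbB
      intro u _ u' _ huu
      rw [addEdge_adj] at huu
      rcases huu with huu | ⟨_, ⟨rfl, rfl⟩ | ⟨rfl, rfl⟩⟩
      · exact ⟨u, hself u, u', hself u', hle huu⟩
      · exact ⟨_, hself _, b, hbs, habadj⟩
      · exact ⟨b, hbs, _, hself _, habadj.symm⟩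

/-! ### The forward direction -/

theorem linkOn_small {V : Type} (G : SimpleGraph V) {U : Set V} (hfin : U.Finite)
    (hU : U.ncard ≤ 5) : LinkOn G U := by
  rintro W P hP ⟨f, f1, f2, f3, f4⟩
  have h6 := card_of_family hP
  choose g hg using fun w => (f2 w).1
  have hinj : Function.Injective (fun w => (⟨g w, f1 w (hg w)⟩ : U)) := by
    intro w w' hw
    by_contra hne
    have hw' : g w = g w' := congrArg Subtype.val hw
    exact f3 w w' hne (g w) (hg w) (hw' ▸ hg w')
  have : Finite U := hfin
  have := Nat.card_le_card_of_injective _ hinj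
  rw [Nat.card_coe_set_eq] at this
  omega

theorem pigeon {V : Type} (C : Fin 3 → Set V) (t : V)
    (h1 : ∀ i j, t ∈ C i → t ∈ C j → C i = C j) (h2 : ∀ i j, t ∉ C i → t ∉ C j → C i = C j) :
    ∃ i j, i ≠ j ∧ C i = C j := by
  by_cases a0 : t ∈ C 0 <;> by_cases a1 : t ∈ C 1
  · exact ⟨0, 1, by decide, h1 _ _ a0 a1⟩
  · by_cases a2 : t ∈ C 2
    · exact ⟨0, 2, by decide, h1 _ _ a0 a2⟩
    · exact ⟨1, 2, by decide, h2 _ _ a1 a2⟩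
  · by_cases a2 : t ∈ C 2
    · exact ⟨1, 2, by decide, h1 _ _ a1 a2⟩
    · exact ⟨0, 2, by decide, h2 _ _ a0 a2⟩
  · exact ⟨0, 1, by decide, h2 _ _ a0 a1⟩

theorem CliqueSum.forward {V : Type} [Finite V] {G : SimpleGraph V} {V₁ V₂ S : Set V}
    (h : CliqueSum G V₁ V₂)
    (hU : V₁ ∪ V₂ = Set.univ) (hI : V₁ ∩ V₂ = S) (hS : S.ncard = 3)
    (l1 : LinkOn G V₁) (l2 : LinkOn G V₂) {t₁ t₂ : V}
    (ht1 : t₁ ∈ V₁) (ht1S : t₁ ∉ S) (a1 : ∀ s ∈ S, G.Adj s t₁) (n1 : ¬ SS G V₁ (insert t₁ S))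
    (ht2 : t₂ ∈ V₂) (ht2S : t₂ ∉ S) (a2 : ∀ s ∈ S, G.Adj s t₂) (n2 : ¬ SS G V₂ (insert t₂ S)) :
    LinkOn (addEdge G t₁ t₂) Set.univ := by
  have hS1 : S ⊆ V₁ := fun s hs => (hI.symm ▸ hs : s ∈ V₁ ∩ V₂).1
  have hS2 : S ⊆ V₂ := fun s hs => (hI.symm ▸ hs : s ∈ V₁ ∩ V₂).2
  have ht12 : t₁ ∉ V₂ := fun h' => ht1S (hI ▸ ⟨ht1, h'⟩)
  have ht21 : t₂ ∉ V₁ := fun h' => ht2S (hI ▸ ⟨h', ht2⟩)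
  have hE : ∀ a b, G.Adj a b → (a ∈ V₁ ∧ b ∈ V₁) ∨ (a ∈ V₂ ∧ b ∈ V₂) := fun a b =>
    h.edge a b (hU ▸ trivial) (hU ▸ trivial)
  have hcl : ∀ a b, a ∈ S → b ∈ S → a ≠ b → G.Adj a b := fun a b ha hb =>
    h.clique a b (hI ▸ ha) (hI ▸ hb)
  have hle := addEdge_le G t₁ t₂
  have g1 : ∀ u ∈ V₁, ∀ v ∈ V₁, ((addEdge G t₁ t₂).Adj u v ↔ G.Adj u v) := by
    intro u hu v hv
    rw [addEdge_adj]
    refine ⟨fun h' => ?_, Or.inl⟩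
    rcases h' with h' | ⟨_, ⟨rfl, rfl⟩ | ⟨rfl, rfl⟩⟩
    · exact h'
    · exact absurd hv ht21
    · exact absurd hu ht21
  have g2 : ∀ u ∈ V₂, ∀ v ∈ V₂, ((addEdge G t₁ t₂).Adj u v ↔ G.Adj u v) := by
    intro u hu v hv
    rw [addEdge_adj]
    refine ⟨fun h' => ?_, Or.inl⟩
    rcases h' with h' | ⟨_, ⟨rfl, rfl⟩ | ⟨rfl, rfl⟩⟩
    · exact h'
    · exact absurd hu ht12
    · exact absurd hv ht12
  have l1' : LinkOn (addEdge G t₁ t₂) V₁ := fun W P hP hm =>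
    l1 P hP (hm.mono subset_rfl fun u hu v hv => (g1 u hu v hv).1)
  have l2' : LinkOn (addEdge G t₁ t₂) V₂ := fun W P hP hm =>
    l2 P hP (hm.mono subset_rfl fun u hu v hv => (g2 u hu v hv).1)
  have hn2 : ∀ v, (addEdge G t₁ t₂).Adj t₂ v → v ∈ V₂ ∨ v = t₁ := by
    intro v hv
    rw [addEdge_adj] at hv
    rcases hv with hv | ⟨_, ⟨h', _⟩ | ⟨_, h'⟩⟩
    · rcases hE _ _ hv with h' | h'
      · exact absurd h'.1 ht21
      · exact Or.inl h'.2
    · exact absurd (h' ▸ ht2) ht12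
    · exact Or.inr h'
  generalize hG' : addEdge G t₁ t₂ = G' at *
  have hclt : ∀ t, t ∉ S → (∀ s ∈ S, G.Adj s t) → ∀ a b, a ∈ insert t S → b ∈ insert t S →
      a ≠ b → G'.Adj a b := by
    rintro t ht hadj a b (rfl | ha) (rfl | hb) hne
    · exact absurd rfl hne
    · exact hle (hadj b hb).symm
    · exact hle (hadj a ha)
    · exact hle (hcl a b ha hb hne)
  have hcard : ∀ t, t ∉ S → (insert t S).ncard = 4 := fun t ht => by
    rw [Set.ncard_insert_of_notMem ht, hS]
  -- first clique sum
  have hI1 : V₁ ∩ insert t₁ (insert t₂ S) = insert t₁ S := by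
    ext v
    constructor
    · rintro ⟨hv1, rfl | rfl | hv⟩
      · exact Or.inl rfl
      · exact absurd hv1 ht21
      · exact Or.inr hv
    · rintro (rfl | hv)
      · exact ⟨ht1, Or.inl rfl⟩
      · exact ⟨hS1 hv, Or.inr (Or.inr hv)⟩
  have hU1 : V₁ ∪ insert t₁ (insert t₂ S) = insert t₂ V₁ := by
    ext v
    constructor
    · rintro (hv | rfl | rfl | hv)
      · exact Or.inr hv
      · exact Or.inr ht1
      · exact Or.inl rfl
      · exact Or.inr (hS1 hv)
    · rintro (rfl | hv)
      · exact Or.inr (Or.inr (Or.inl rfl))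
      · exact Or.inl hv
  have hnb : ∀ v ∈ insert t₂ V₁, G'.Adj t₂ v → v ∈ insert t₁ (insert t₂ S) := by
    intro v hv hadj
    rcases hn2 v hadj with hv2 | rfl
    · rcases hv with rfl | hv1
      · exact Or.inr (Or.inl rfl)
      · exact Or.inr (Or.inr (hI ▸ ⟨hv1, hv2⟩))
    · exact Or.inl rfl
  have cs1 : CliqueSum G' V₁ (insert t₁ (insert t₂ S)) := by
    constructor
    · rw [hU1]
      intro a b ha hb hab
      rcases ha with rfl | ha
      · exact Or.inr ⟨Or.inr (Or.inl rfl), hnb b hb hab⟩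
      · rcases hb with rfl | hb
        · exact Or.inr ⟨hnb a (Or.inr ha) hab.symm, Or.inr (Or.inl rfl)⟩
        · exact Or.inl ⟨ha, hb⟩
    · rw [hI1]
      exact hclt t₁ ht1S a1
  have hK5 : LinkOn G' (insert t₁ (insert t₂ S)) := by
    refine linkOn_small _ (Set.toFinite _) ?_
    refine (Set.ncard_insert_le _ _).trans ?_
    rw [hcard t₂ ht2S]
  have step1 : LinkOn G' (insert t₂ V₁) := by
    have := cs1.main (Set.toFinite _) (by rw [hI1, hcard t₁ ht1S]) l1' hK5 ?_
    · rwa [hU1] at this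
    rw [hI1, hU1]
    intro _ C hC hfull
    refine pigeon C t₂ (fun i j hi hj => (hC i).eq (hC j) ⟨t₂, hi, hj⟩) ?_
    intro i j hi hj
    by_contra hne
    have key : ∀ i, t₂ ∉ C i → IsComp G (V₁ \ insert t₁ S) (C i) := by
      intro i hi
      refine (hC i).transfer ?_ ?_ ?_
      · intro v hv
        refine ⟨((hC i).2.1 hv).1.resolve_left ?_, ((hC i).2.1 hv).2⟩
        rintro rfl
        exact hi hv
      · exact fun v hv => ⟨Or.inr hv.1, hv.2⟩
      · exact fun u hu v hv => g1 u hu.1 v hv.1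
    have hTV : insert t₁ S ⊆ V₁ := Set.insert_subset ht1 hS1
    have full : ∀ i, t₂ ∉ C i → ∀ s ∈ insert t₁ S, ∃ u ∈ C i, G.Adj s u := by
      intro i hi s hs
      obtain ⟨u, hu, h'⟩ := hfull i s hs
      exact ⟨u, hu, (g1 s (hTV hs) u ((key i hi).2.1 hu).1).1 h'⟩
    exact n1 ⟨C i, C j, key i hi, key j hj, hne, fun s hs => ⟨full i hi s hs, full j hj s hs⟩⟩
  -- second clique sum
  have hI2 : insert t₂ V₁ ∩ V₂ = insert t₂ S := by
    ext v
    constructor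
    · rintro ⟨rfl | hv, hv2⟩
      · exact Or.inl rfl
      · exact Or.inr (hI ▸ ⟨hv, hv2⟩)
    · rintro (rfl | hv)
      · exact ⟨Or.inl rfl, ht2⟩
      · exact ⟨Or.inr (hS1 hv), hS2 hv⟩
  have hU2 : insert t₂ V₁ ∪ V₂ = Set.univ := by
    rw [Set.insert_union, hU, Set.insert_eq_of_mem (Set.mem_univ _)]
  have cs2 : CliqueSum G' (insert t₂ V₁) V₂ := by
    constructor
    · intro a b _ _ hab
      rw [← hG', addEdge_adj] at hab
      rcases hab with hab | ⟨_, ⟨rfl, rfl⟩ | ⟨rfl, rfl⟩⟩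
      · rcases hE a b hab with h' | h'
        · exact Or.inl ⟨Or.inr h'.1, Or.inr h'.2⟩
        · exact Or.inr h'
      · exact Or.inl ⟨Or.inr ht1, Or.inl rfl⟩
      · exact Or.inl ⟨Or.inl rfl, Or.inr ht1⟩
    · rw [hI2]
      exact hclt t₂ ht2S a2
  have := cs2.main (Set.toFinite _) (by rw [hI2, hcard t₂ ht2S]) step1 l2' ?_
  · rwa [hU2] at this
  rw [hI2, hU2]
  intro _ C hC hfull
  refine pigeon C t₁ (fun i j hi hj => (hC i).eq (hC j) ⟨t₁, hi, hj⟩) ?_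
  intro i j hi hj
  by_contra hne
  have key : ∀ i, t₁ ∉ C i → IsComp G (V₂ \ insert t₂ S) (C i) := by
    intro i hi
    obtain ⟨u, hu, hadj⟩ := hfull i t₂ (Or.inl rfl)
    have hu2 : u ∈ V₂ := (hn2 u hadj).resolve_right (fun h' => hi (h' ▸ hu))
    have hC2 : C i ⊆ V₂ := cs2.symm.side (hC i).1
      (fun v _ => by rw [Set.union_comm, hU2]; trivial)
      (fun v hv => by rw [Set.inter_comm, hI2]; exact ((hC i).2.1 hv).2) hu hu2
    refine (hC i).transfer ?_ ?_ ?_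
    · exact fun v hv => ⟨hC2 hv, ((hC i).2.1 hv).2⟩
    · exact fun v hv => ⟨trivial, hv.2⟩
    · exact fun u hu v hv => g2 u hu.1 v hv.1
  have hTV : insert t₂ S ⊆ V₂ := Set.insert_subset ht2 hS2
  have full : ∀ i, t₁ ∉ C i → ∀ s ∈ insert t₂ S, ∃ u ∈ C i, G.Adj s u := by
    intro i hi s hs
    obtain ⟨u, hu, h'⟩ := hfull i s hs
    exact ⟨u, hu, (g2 s (hTV hs) u ((key i hi).2.1 hu).1).1 h'⟩
  exact n2 ⟨C i, C j, key i hi, key j hj, hne, fun s hs => ⟨full i hi s hs, full j hj s hs⟩⟩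

/-- Let `G` be the clique sum of maxnil graphs `G₁ = G.induce V₁` and `G₂ = G.induce V₂`
over the triangle `{x, y, z} = V₁ ∩ V₂`, which is a minimal vertex cut set of `G`.
Then `G` is maxnil iff for some `i ∈ {1, 2}`, every induced `K₄` subgraph of `Gᵢ` of
the form `⟨x, y, z, t⟩` is strongly separating in `Gᵢ`. -/
theorem stmt_9 {V : Type} [Fintype V] (G : SimpleGraph V) (V₁ V₂ : Set V) (x y z : V)
    (hU : V₁ ∪ V₂ = Set.univ) (hI : V₁ ∩ V₂ = {x, y, z})
    (hxy : x ≠ y) (hxz : x ≠ z) (hyz : y ≠ z)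
    (hx₁ : x ∈ V₁) (hy₁ : y ∈ V₁) (hz₁ : z ∈ V₁)
    (hx₂ : x ∈ V₂) (hy₂ : y ∈ V₂) (hz₂ : z ∈ V₂)
    (hΔ : G.Adj x y ∧ G.Adj y z ∧ G.Adj x z)
    (hE : ∀ a b : V, G.Adj a b → (a ∈ V₁ ∧ b ∈ V₁) ∨ (a ∈ V₂ ∧ b ∈ V₂))
    (h₁ : IsMaxnil (G.induce V₁)) (h₂ : IsMaxnil (G.induce V₂))
    (hmin : IsMinimalVertexCut G {x, y, z}) :
    IsMaxnil G ↔
      ((∀ t : V, ∀ ht : t ∈ V₁, t ∉ ({x, y, z} : Set V) →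
          G.Adj x t → G.Adj y t → G.Adj z t →
          StronglySeparating (G.induce V₁)
            {⟨x, hx₁⟩, ⟨y, hy₁⟩, ⟨z, hz₁⟩, ⟨t, ht⟩}) ∨
       (∀ t : V, ∀ ht : t ∈ V₂, t ∉ ({x, y, z} : Set V) →
          G.Adj x t → G.Adj y t → G.Adj z t →
          StronglySeparating (G.induce V₂)
            {⟨x, hx₂⟩, ⟨y, hy₂⟩, ⟨z, hz₂⟩, ⟨t, ht⟩})) := by
  have hcs : CliqueSum G V₁ V₂ := by
    refine ⟨fun a b _ _ => hE a b, ?_⟩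
    rw [hI]
    obtain ⟨q1, q2, q3⟩ := hΔ
    rintro a b (rfl | rfl | rfl) (rfl | rfl | rfl) hne
    · exact absurd rfl hne
    · exact q1
    · exact q3
    · exact q1.symm
    · exact absurd rfl hne
    · exact q2
    · exact q3.symm
    · exact q2.symm
    · exact absurd rfl hne
  have hS3 : ({x, y, z} : Set V).ncard = 3 := by
    rw [Set.ncard_eq_three]
    exact ⟨x, y, z, hxy, hxz, hyz, rfl⟩
  have l1 := (isLinkless_induce_iff G V₁).1 h₁.1
  have l2 := (isLinkless_induce_iff G V₂).1 h₂.1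
  have him : ∀ (U : Set V) (hx : x ∈ U) (hy : y ∈ U) (hz : z ∈ U) (t : V) (ht : t ∈ U),
      Subtype.val '' ({⟨x, hx⟩, ⟨y, hy⟩, ⟨z, hz⟩, ⟨t, ht⟩} : Set U) = insert t {x, y, z} := by
    intro U hx hy hz t ht
    ext v
    simp only [Set.image_insert_eq, Set.image_singleton, Set.mem_insert_iff,
      Set.mem_singleton_iff]
    tauto
  constructor
  · intro hmax
    by_contra hno
    rw [not_or] at hno
    obtain ⟨n1, n2⟩ := hno
    push Not at n1 n2
    obtain ⟨t₁, ht1, ht1S, ax1, ay1, az1, ns1⟩ := n1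
    obtain ⟨t₂, ht2, ht2S, ax2, ay2, az2, ns2⟩ := n2
    have ht21 : t₂ ∉ V₁ := fun h => ht2S (hI ▸ ⟨h, ht2⟩)
    have ht12 : t₁ ∉ V₂ := fun h => ht1S (hI ▸ ⟨ht1, h⟩)
    refine hmax.2 t₁ t₂ (fun h => ht21 (h ▸ ht1)) ?_ ?_
    · intro hadj
      rcases hE _ _ hadj with h | h
      · exact ht21 h.2
      · exact ht12 h.1
    · rw [isLinkless_iff]
      refine hcs.forward hU hI hS3 l1 l2 ht1 ht1S ?_ ?_ ht2 ht2S ?_ ?_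
      · rintro s (rfl | rfl | rfl) <;> assumption
      · intro hss
        exact ns1 (stronglySeparating_of_ss (by rw [him]; exact hss))
      · rintro s (rfl | rfl | rfl) <;> assumption
      · intro hss
        exact ns2 (stronglySeparating_of_ss (by rw [him]; exact hss))
  · intro hcond
    have hlinkG : LinkOn G Set.univ := by
      have := hcs.main (Set.toFinite _) (by rw [hI, hS3]; norm_num) l1 l2
        (by rw [hI, hS3]; intro h; omega)
      rwa [hU] at this
    refine ⟨(isLinkless_iff G).2 hlinkG, ?_⟩
    have hmono : ∀ (U : Set V) (a b : V), ¬ LinkOn (addEdge G a b) U →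
        ¬ LinkOn (addEdge G a b) Set.univ := fun U a b h h' =>
      h fun W P hP hm => h' P hP (hm.mono (Set.subset_univ _) fun _ _ _ _ h => h)
    have hp : Function.Injective ![x, y, z] := by
      intro i j hij
      fin_cases i <;> fin_cases j <;> simp_all
    have hr : ({x, y, z} : Set V) = Set.range ![x, y, z] := by
      ext v
      simp only [Set.mem_insert_iff, Set.mem_singleton_iff, Set.mem_range]
      constructor
      · rintro (rfl | rfl | rfl)
        · exact ⟨0, rfl⟩
        · exact ⟨1, rfl⟩
        · exact ⟨2, rfl⟩
      · rintro ⟨i, rfl⟩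
        fin_cases i <;> simp
    have hatt : ∀ C, IsComp G ({x, y, z} : Set V)ᶜ C → ∀ s ∈ ({x, y, z} : Set V),
        ∃ u ∈ C, G.Adj s u := fun C hC s hs => attached_of_minimal hmin hC hs
    have cross : ∀ a ∈ V₁, a ∉ ({x, y, z} : Set V) → ∀ b ∈ V₂, b ∉ ({x, y, z} : Set V) →
        ¬ LinkOn (addEdge G a b) Set.univ := by
      intro a ha haS b hb hbS
      rcases hcond with hc | hc
      · refine hcs.back hU hI _ hp hr h₁ hatt ?_ ha haS hb hbS
        intro t ht htS hadj
        have := ss_of_stronglySeparating (hc t ht htS (hadj x (by simp)) (hadj y (by simp))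
          (hadj z (by simp)))
        rwa [him] at this
      · rw [addEdge_comm]
        refine hcs.symm.back (by rw [Set.union_comm, hU]) (by rw [Set.inter_comm, hI]) _ hp hr h₂
          hatt ?_ hb hbS ha haS
        intro t ht htS hadj
        have := ss_of_stronglySeparating (hc t ht htS (hadj x (by simp)) (hadj y (by simp))
          (hadj z (by simp)))
        rwa [him] at this
    intro a b hab hn
    rw [isLinkless_iff]
    by_cases ha1 : a ∈ V₁
    · by_cases hb1 : b ∈ V₁
      · exact hmono V₁ a b (not_linkless_of_side h₁ ha1 hb1 hab hn)
      have hb2 : b ∈ V₂ := (hU.symm ▸ Set.mem_univ b : b ∈ V₁ ∪ V₂).resolve_left hb1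
      by_cases ha2 : a ∈ V₂
      · exact hmono V₂ a b (not_linkless_of_side h₂ ha2 hb2 hab hn)
      exact cross a ha1 (fun h => ha2 (hI.symm ▸ h : a ∈ V₁ ∩ V₂).2) b hb2
        (fun h => hb1 (hI.symm ▸ h : b ∈ V₁ ∩ V₂).1)
    · have ha2 : a ∈ V₂ := (hU.symm ▸ Set.mem_univ a : a ∈ V₁ ∪ V₂).resolve_left ha1
      by_cases hb2 : b ∈ V₂
      · exact hmono V₂ a b (not_linkless_of_side h₂ ha2 hb2 hab hn)
      have hb1 : b ∈ V₁ := (hU.symm ▸ Set.mem_univ b : b ∈ V₁ ∪ V₂).resolve_right hb2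
      rw [addEdge_comm]
      exact cross b hb1 (fun h => hb2 (hI.symm ▸ h : b ∈ V₁ ∩ V₂).2) a ha2
        (fun h => ha1 (hI.symm ▸ h : a ∈ V₁ ∩ V₂).1)
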